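/- Let P be an abstract simplicial complex on a finite vertex set V whose geometric realization ‖P‖ is homeomorphic to the sphere S^{d−1}, and let K be a field. Let SR(P) be the set of minimal non-faces of P, and let U_SR be the collection of all subsets of V expressible as a union of elements of SR(P). Then for every subset I ⊆ V and every integer i ≥ 1, the reduced homology H̃_{d−1−i}(P_{≤Î}; K) vanishes unless I ∈ U_SR, where Î = V∖I. -/

import Mathlib

open Finset

/-- An abstract simplicial complex on a vertex type `V`: a collection of finite subsets of `V`
(called faces) closed under taking subsets. -/
structure ASC (V : Type) where
  faces : Set (Finset V)
  down_closed : ∀ ⦃σ τ : Finset V⦄, σ ∈ faces → τ ⊆ σ → τ ∈ faces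

namespace ASC

variable {V : Type}

/-- `Γ.restrict σ` is the subcomplex `Γ_{≤σ}` of all faces of `Γ` contained in `σ`. -/
def restrict (Γ : ASC V) (σ : Finset V) : ASC V where
  faces := {τ | τ ∈ Γ.faces ∧ τ ⊆ σ}
  down_closed := by
    intro τ τ' h hsub
    exact ⟨Γ.down_closed h.1 hsub, hsub.trans h.2⟩

/-- The link of `σ` in `Γ`: all faces `τ` with `τ ∪ σ ∈ Γ` and `τ ∩ σ = ∅`. -/
def link [DecidableEq V] (Γ : ASC V) (σ : Finset V) : ASC V where
  faces := {τ | τ ∪ σ ∈ Γ.faces ∧ τ ∩ σ = ∅}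
  down_closed := by
    intro τ τ' h hsub
    refine ⟨Γ.down_closed h.1 (Finset.union_subset_union hsub (Finset.Subset.refl σ)), ?_⟩
    rw [← Finset.subset_empty, ← h.2]
    exact Finset.inter_subset_inter hsub (Finset.Subset.refl σ)

/-- The Alexander dual `Γ* = {σ ⊆ V ∣ V∖σ ∉ Γ}`. -/
def dual [DecidableEq V] [Fintype V] (Γ : ASC V) : ASC V where
  faces := {σ | σᶜ ∉ Γ.faces}
  down_closed := by
    intro σ τ hσ hsub hmem
    exact hσ (Γ.down_closed hmem (Finset.compl_subset_compl.mpr hsub))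

/-- A maximal face (facet) of `Γ`. -/
def IsMaximalFace (Γ : ASC V) (τ : Finset V) : Prop :=
  τ ∈ Γ.faces ∧ ∀ τ' ∈ Γ.faces, τ ⊆ τ' → τ' = τ

/-- A minimal non-face of `Γ`: not a face of `Γ`, but all of its proper subsets are faces. -/
def IsMinimalNonFace (Γ : ASC V) (J : Finset V) : Prop :=
  J ∉ Γ.faces ∧ ∀ J' ⊂ J, J' ∈ Γ.faces

/-- `I` belongs to `U_SR`: it is a union of (a nonempty finite family of)
minimal non-faces of `Γ`. -/
def memUSR [DecidableEq V] (Γ : ASC V) (I : Finset V) : Prop :=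
  ∃ S : Finset (Finset V), S.Nonempty ∧ (∀ J ∈ S, Γ.IsMinimalNonFace J) ∧ I = S.sup id

section Homology

variable (K : Type) [Field K] [LinearOrder V]

/-- The `j`-dimensional faces of `Γ` (faces of cardinality `j + 1`). -/
def Cells (Γ : ASC V) (j : ℤ) : Type :=
  {σ : Finset V // σ ∈ Γ.faces ∧ (σ.card : ℤ) = j + 1}

/-- The space of simplicial `j`-chains with coefficients in `K`, i.e. the free `K`-module on the
`j`-dimensional faces.  (This is the augmented/reduced chain complex: the empty face, if present,
spans the chains in degree `-1`.) -/
def Chains (Γ : ASC V) (j : ℤ) : Type := Cells Γ j →₀ K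

noncomputable instance (Γ : ASC V) (j : ℤ) : AddCommGroup (Chains K Γ j) :=
  inferInstanceAs (AddCommGroup (Cells Γ j →₀ K))

noncomputable instance (Γ : ASC V) (j : ℤ) : Module K (Chains K Γ j) :=
  inferInstanceAs (Module K (Cells Γ j →₀ K))

/-- The simplicial boundary map from `j`-chains to `k = (j-1)`-chains, with the usual
alternating signs determined by the linear order on the vertices. -/
noncomputable def boundary (Γ : ASC V) (j k : ℤ) (hk : k = j - 1) :
    Chains K Γ j →ₗ[K] Chains K Γ k :=
  Finsupp.lsum K fun σ : Cells Γ j =>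
    LinearMap.toSpanSingleton K (Chains K Γ k)
      (∑ v ∈ σ.1.attach,
        (Finsupp.single
          (⟨σ.1.erase v.1,
            Γ.down_closed σ.2.1 (Finset.erase_subset _ _), by
              have h1 := Finset.card_erase_of_mem v.2
              have h2 : 1 ≤ σ.1.card := Finset.card_pos.mpr ⟨v.1, v.2⟩
              have h3 := σ.2.2
              omega⟩ : Cells Γ k)
          ((-1 : K) ^ (σ.1.filter (fun w => w < v.1)).card) : Cells Γ k →₀ K))

/-- Reduced simplicial homology of `Γ` in degree `j` with coefficients in `K`:
cycles modulo (cycles that are boundaries). -/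
noncomputable abbrev reducedHomology (Γ : ASC V) (j : ℤ) : Type :=
  ↥(LinearMap.ker (boundary K Γ j (j - 1) rfl)) ⧸
    Submodule.comap (LinearMap.ker (boundary K Γ j (j - 1) rfl)).subtype
      (LinearMap.range (boundary K Γ (j + 1) j (by omega)))

/-- Simplicial `j`-cochains: the `K`-linear dual of the space of `j`-chains. -/
def Cochains (Γ : ASC V) (j : ℤ) : Type := Chains K Γ j →ₗ[K] K

noncomputable instance (Γ : ASC V) (j : ℤ) : AddCommGroup (Cochains K Γ j) :=
  inferInstanceAs (AddCommGroup (Chains K Γ j →ₗ[K] K))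

noncomputable instance (Γ : ASC V) (j : ℤ) : Module K (Cochains K Γ j) :=
  inferInstanceAs (Module K (Chains K Γ j →ₗ[K] K))

/-- The simplicial coboundary map, the dual of the boundary map. -/
noncomputable def coboundary (Γ : ASC V) (j k : ℤ) (hk : k = j + 1) :
    Cochains K Γ j →ₗ[K] Cochains K Γ k :=
  (boundary K Γ k j (by omega)).dualMap

/-- Reduced simplicial cohomology of `Γ` in degree `j` with coefficients in `K`:
cocycles modulo (cocycles that are coboundaries). -/
noncomputable abbrev reducedCohomology (Γ : ASC V) (j : ℤ) : Type :=
  ↥(LinearMap.ker (coboundary K Γ j (j + 1) rfl)) ⧸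
    Submodule.comap (LinearMap.ker (coboundary K Γ j (j + 1) rfl)).subtype
      (LinearMap.range (coboundary K Γ (j - 1) j (by omega)))

end Homology

/-- The geometric realization `‖Γ‖` of `Γ`, as the subset of `V → ℝ` consisting of the
convex-weight functions whose support is a face of `Γ`. -/
def realization [Fintype V] (Γ : ASC V) : Set (V → ℝ) :=
  {x | (∀ v, 0 ≤ x v) ∧ (∑ v, x v) = 1 ∧ ∃ τ ∈ Γ.faces, ∀ v, x v ≠ 0 ↔ v ∈ τ}

end ASC

namespace ListChain

section Algebra

variable {K : Type*} [Field K] {X Y α β : Type*}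

theorem map_mem_supported (f : (α →₀ K) →ₗ[K] (β →₀ K)) {s : Set α} {t : Set β}
    (h : ∀ a ∈ s, f (Finsupp.single a 1) ∈ Finsupp.supported K K t) {z : α →₀ K}
    (hz : z ∈ Finsupp.supported K K s) : f z ∈ Finsupp.supported K K t := by
  rw [Finsupp.supported_eq_span_single] at hz
  have : Submodule.span K ((fun i => Finsupp.single i (1 : K)) '' s) ≤
      (Finsupp.supported K K t).comap f := by
    rw [Submodule.span_le]
    rintro _ ⟨a, ha, rfl⟩
    exact h a ha
  exact this hz

theorem eq_on_supported {M : Type*} [AddCommGroup M] [Module K M] (f g : (α →₀ K) →ₗ[K] M)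
    {s : Set α} (h : ∀ a ∈ s, f (Finsupp.single a 1) = g (Finsupp.single a 1)) {z : α →₀ K}
    (hz : z ∈ Finsupp.supported K K s) : f z = g z := by
  rw [Finsupp.supported_eq_span_single] at hz
  have : Submodule.span K ((fun i => Finsupp.single i (1 : K)) '' s) ≤
      LinearMap.eqLocus f g := by
    rw [Submodule.span_le]
    rintro _ ⟨a, ha, rfl⟩
    exact h a ha
  exact this hz

variable (K) in
/-- The cone operator on chains of lists: put `x` in front of every list. -/
noncomputable def cone (x : X) : (List X →₀ K) →ₗ[K] (List X →₀ K) :=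
  Finsupp.lmapDomain K K (List.cons x)

@[simp]
theorem cone_single (x : X) (l : List X) (a : K) :
    cone K x (Finsupp.single l a) = Finsupp.single (x :: l) a := by
  simp [cone]

variable (K) in
/-- The alternating boundary of a list, regarded as an ordered simplex with possible
repetitions. -/
noncomputable def bdryList : List X → (List X →₀ K)
  | [] => 0
  | x :: t => Finsupp.single t 1 - cone K x (bdryList t)

variable (K) in
/-- The (augmented) boundary operator on the free module on lists. -/
noncomputable def bdry : (List X →₀ K) →ₗ[K] (List X →₀ K) :=
  Finsupp.linearCombination K (bdryList K)

theorem bdry_single (l : List X) : bdry K (Finsupp.single l 1) = bdryList K l := by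
  simp [bdry]

@[simp]
theorem bdry_nil : bdry K (Finsupp.single ([] : List X) 1) = 0 := by
  rw [bdry_single, bdryList]

theorem bdry_cons (x : X) (t : List X) :
    bdry K (Finsupp.single (x :: t) 1) =
      Finsupp.single t 1 - cone K x (bdry K (Finsupp.single t 1)) := by
  rw [bdry_single, bdryList, bdry_single]

theorem bdry_cone (x : X) (c : List X →₀ K) :
    bdry K (cone K x c) = c - cone K x (bdry K c) := by
  have : (bdry K).comp (cone K x) = LinearMap.id - (cone K x).comp (bdry K) := by
    refine Finsupp.lhom_ext' fun l => LinearMap.ext_ring ?_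
    simp [bdry_cons]
  exact LinearMap.congr_fun this c

theorem bdry_bdry (c : List X →₀ K) : bdry K (bdry K c) = 0 := by
  have : (bdry K).comp (bdry K) = (0 : (List X →₀ K) →ₗ[K] (List X →₀ K)) := by
    refine Finsupp.lhom_ext' fun l => LinearMap.ext_ring ?_
    simp only [LinearMap.comp_apply, Finsupp.lsingle_apply, LinearMap.zero_apply]
    induction l with
    | nil => simp
    | cons x t ih => rw [bdry_cons, map_sub, bdry_cone, ih]; simp
  exact LinearMap.congr_fun this c

variable (K) in
/-- The map on chains of lists induced by a map of points. -/
noncomputable def pushList (f : X → Y) : (List X →₀ K) →ₗ[K] (List Y →₀ K) :=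
  Finsupp.lmapDomain K K (List.map f)

@[simp]
theorem pushList_single (f : X → Y) (l : List X) (a : K) :
    pushList K f (Finsupp.single l a) = Finsupp.single (l.map f) a := by
  simp [pushList]

theorem pushList_cone (f : X → Y) (x : X) (c : List X →₀ K) :
    pushList K f (cone K x c) = cone K (f x) (pushList K f c) := by
  have : (pushList K f).comp (cone K x) = (cone K (f x)).comp (pushList K f) := by
    refine Finsupp.lhom_ext' fun l => LinearMap.ext_ring ?_
    simp
  exact LinearMap.congr_fun this c

theorem bdry_pushList (f : X → Y) (c : List X →₀ K) :
    bdry K (pushList K f c) = pushList K f (bdry K c) := by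
  have : (bdry K).comp (pushList K f) = (pushList K f).comp (bdry K) := by
    refine Finsupp.lhom_ext' fun l => LinearMap.ext_ring ?_
    simp only [LinearMap.comp_apply, Finsupp.lsingle_apply]
    induction l with
    | nil => simp
    | cons x t ih =>
      rw [pushList_single, List.map_cons, bdry_cons, bdry_cons, map_sub, pushList_cone, ← ih]
      simp
  exact LinearMap.congr_fun this c

theorem pushList_comp {Z : Type*} (f : X → Y) (g : Y → Z) (z : List X →₀ K) :
    pushList K g (pushList K f z) = pushList K (g ∘ f) z := by
  have : (pushList K g).comp (pushList K f) = pushList K (g ∘ f) := by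
    refine Finsupp.lhom_ext' fun l => LinearMap.ext_ring ?_
    simp
  exact LinearMap.congr_fun this z

variable (K) in
/-- The prism on a list between its images under `f` and `g`. -/
noncomputable def prismList (f g : X → Y) : List X → (List Y →₀ K)
  | [] => 0
  | x :: t => Finsupp.single (f x :: g x :: t.map g) 1 - cone K (f x) (prismList f g t)

variable (K) in
/-- The prism operator, a chain homotopy from `pushList f` to `pushList g`. -/
noncomputable def prism (f g : X → Y) : (List X →₀ K) →ₗ[K] (List Y →₀ K) :=
  Finsupp.linearCombination K (prismList K f g)

theorem prism_single (f g : X → Y) (l : List X) :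
    prism K f g (Finsupp.single l 1) = prismList K f g l := by
  simp [prism]

@[simp]
theorem prism_nil (f g : X → Y) : prism K f g (Finsupp.single ([] : List X) 1) = 0 := by
  rw [prism_single, prismList]

theorem prism_cons (f g : X → Y) (x : X) (t : List X) :
    prism K f g (Finsupp.single (x :: t) 1) =
      Finsupp.single (f x :: g x :: t.map g) 1 -
        cone K (f x) (prism K f g (Finsupp.single t 1)) := by
  rw [prism_single, prismList, prism_single]

theorem prism_cone (f g : X → Y) (x : X) (c : List X →₀ K) :
    prism K f g (cone K x c) =
      cone K (f x) (cone K (g x) (pushList K g c)) - cone K (f x) (prism K f g c) := by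
  have : (prism K f g).comp (cone K x) =
      (cone K (f x)).comp ((cone K (g x)).comp (pushList K g)) -
        (cone K (f x)).comp (prism K f g) := by
    refine Finsupp.lhom_ext' fun l => LinearMap.ext_ring ?_
    simp [prism_cons]
  exact LinearMap.congr_fun this c

theorem bdry_prism (f g : X → Y) (c : List X →₀ K) :
    bdry K (prism K f g c) = pushList K g c - pushList K f c - prism K f g (bdry K c) := by
  have : (bdry K).comp (prism K f g) =
      pushList K g - pushList K f - (prism K f g).comp (bdry K) := by
    refine Finsupp.lhom_ext' fun l => LinearMap.ext_ring ?_
    simp only [LinearMap.comp_apply, Finsupp.lsingle_apply, LinearMap.sub_apply]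
    induction l with
    | nil => simp
    | cons x t ih =>
      rw [prism_cons, map_sub, bdry_cone, ih, bdry_cons, bdry_cons, bdry_cons, map_sub,
        map_sub (prism K f g), prism_cone, ← pushList_single, bdry_pushList]
      simp only [map_sub, pushList_single, cone_single, List.map_cons]
      abel
  exact LinearMap.congr_fun this c

theorem supported_mono' {s t : Set α} (h : s ⊆ t) {z : α →₀ K}
    (hz : z ∈ Finsupp.supported K K s) : z ∈ Finsupp.supported K K t :=
  Finsupp.supported_mono h hz

theorem bdryList_mem (l : List X) :
    bdryList K l ∈ Finsupp.supported K K {l' : List X | l'.length + 1 = l.length ∧ l' ⊆ l} := by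
  induction l with
  | nil => simp [bdryList]
  | cons x t ih =>
    rw [bdryList]
    refine Submodule.sub_mem _ (Finsupp.single_mem_supported K 1 ⟨rfl, by simp⟩) ?_
    refine map_mem_supported _ ?_ ih
    rintro l ⟨h1, h2⟩
    rw [cone_single]
    refine Finsupp.single_mem_supported K 1 ⟨by simp [h1], ?_⟩
    exact List.cons_subset_cons x h2

theorem prismList_mem (f g : X → Y) (l : List X) :
    prismList K f g l ∈ Finsupp.supported K K
      {l' : List Y | l'.length = l.length + 1 ∧ ∀ y ∈ l', ∃ x ∈ l, y = f x ∨ y = g x} := by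
  induction l with
  | nil => simp [prismList]
  | cons x t ih =>
    rw [prismList]
    refine Submodule.sub_mem _ (Finsupp.single_mem_supported K 1 ⟨by simp, ?_⟩) ?_
    · intro y hy
      simp only [List.mem_cons, List.mem_map] at hy
      rcases hy with rfl | rfl | ⟨a, ha, rfl⟩
      · exact ⟨x, by simp, Or.inl rfl⟩
      · exact ⟨x, by simp, Or.inr rfl⟩
      · exact ⟨a, by simp [ha], Or.inr rfl⟩
    · refine map_mem_supported _ ?_ ih
      rintro l ⟨h1, h2⟩
      rw [cone_single]
      refine Finsupp.single_mem_supported K 1 ⟨by simp [h1], ?_⟩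
      intro y hy
      rcases List.mem_cons.1 hy with rfl | hy
      · exact ⟨x, by simp, Or.inl rfl⟩
      · obtain ⟨a, ha, h⟩ := h2 y hy
        exact ⟨a, by simp [ha], h⟩

end Algebra

section Small

variable {K : Type*} [Field K] {X Y : Type*} [PseudoMetricSpace X] [PseudoMetricSpace Y]

/-- Lists of length `m` of points of `C` whose pairwise distances are less than `ε`. -/
def smallLists (m : ℕ) (ε : ℝ) (C : Set X) : Set (List X) :=
  {l | l.length = m ∧ (∀ x ∈ l, x ∈ C) ∧ ∀ x ∈ l, ∀ y ∈ l, dist x y < ε}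

theorem smallLists_mono {m : ℕ} {ε ε' : ℝ} {C C' : Set X} (h : ε ≤ ε') (hC : C ⊆ C') :
    smallLists m ε C ⊆ smallLists m ε' C' := fun _ hl =>
  ⟨hl.1, fun x hx => hC (hl.2.1 x hx), fun x hx y hy => (hl.2.2 x hx y hy).trans_le h⟩

variable (K) in
/-- Chains of `ε`-small ordered simplices with `m` vertices in `C`. -/
noncomputable abbrev small (m : ℕ) (ε : ℝ) (C : Set X) : Submodule K (List X →₀ K) :=
  Finsupp.supported K K (smallLists m ε C)

theorem small_mono {m : ℕ} {ε ε' : ℝ} {C C' : Set X} (h : ε ≤ ε') (hC : C ⊆ C')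
    {z : List X →₀ K} (hz : z ∈ small K m ε C) : z ∈ small K m ε' C' :=
  supported_mono' (smallLists_mono h hC) hz

theorem small_inter {m : ℕ} {ε : ℝ} {C C' : Set X} {z : List X →₀ K}
    (hz : z ∈ small K m ε C) (hz' : z ∈ small K m ε C') : z ∈ small K m ε (C ∩ C') := by
  have : z ∈ Finsupp.supported K K (smallLists m ε C ∩ smallLists m ε C') := by
    rw [Finsupp.supported_inter]
    exact ⟨hz, hz'⟩
  refine supported_mono' ?_ this
  rintro l ⟨h, h'⟩
  exact ⟨h.1, fun x hx => ⟨h.2.1 x hx, h'.2.1 x hx⟩, h.2.2⟩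

theorem bdry_mem_small {m : ℕ} {ε : ℝ} {C : Set X} {z : List X →₀ K}
    (hz : z ∈ small K (m + 1) ε C) : bdry K z ∈ small K m ε C := by
  refine map_mem_supported _ ?_ hz
  intro l hl
  rw [bdry_single]
  refine supported_mono' ?_ (bdryList_mem l)
  rintro l' ⟨h1, h2⟩
  exact ⟨by have := hl.1; omega, fun x hx => hl.2.1 x (h2 hx),
    fun x hx y hy => hl.2.2 x (h2 hx) y (h2 hy)⟩

variable (K) in
/-- Sufficiently small cycles with `m` vertices in `C` bound small chains in `C'`. -/
def Null (m : ℕ) (C C' : Set X) : Prop :=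
  ∀ ε > 0, ∃ δ > 0, ∀ z ∈ small K m δ C, bdry K z = 0 →
    ∃ w ∈ small K (m + 1) ε C', bdry K w = z

theorem Null.mono {m : ℕ} {C D C' D' : Set X} (h : Null K m C C') (hC : D ⊆ C) (hD : C' ⊆ D') :
    Null K m D D' := by
  intro ε hε
  obtain ⟨δ, hδ, H⟩ := h ε hε
  refine ⟨δ, hδ, fun z hz hz' => ?_⟩
  obtain ⟨w, hw, h⟩ := H z (small_mono le_rfl hC hz) hz'
  exact ⟨w, small_mono le_rfl hD hw, h⟩

theorem pushList_mem_small {m : ℕ} {ε δ : ℝ} {C : Set X} {D : Set Y} (f : X → Y)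
    (hf : Set.MapsTo f C D) (hd : ∀ x ∈ C, ∀ y ∈ C, dist x y < δ → dist (f x) (f y) < ε)
    {z : List X →₀ K} (hz : z ∈ small K m δ C) : pushList K f z ∈ small K m ε D := by
  refine map_mem_supported _ ?_ hz
  intro l hl
  rw [pushList_single]
  refine Finsupp.single_mem_supported K 1 ⟨by simp [hl.1], ?_, ?_⟩
  · intro y hy
    obtain ⟨x, hx, rfl⟩ := List.mem_map.1 hy
    exact hf (hl.2.1 x hx)
  · intro y hy y' hy'
    obtain ⟨x, hx, rfl⟩ := List.mem_map.1 hy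
    obtain ⟨x', hx', rfl⟩ := List.mem_map.1 hy'
    exact hd x (hl.2.1 x hx) x' (hl.2.1 x' hx') (hl.2.2 x hx x' hx')

theorem pushList_eq_self {m : ℕ} {δ : ℝ} {C : Set X} {f : X → X} (hf : ∀ x ∈ C, f x = x)
    {z : List X →₀ K} (hz : z ∈ small K m δ C) : pushList K f z = z := by
  refine eq_on_supported (pushList K f) LinearMap.id ?_ hz
  intro l hl
  rw [pushList_single, LinearMap.id_apply, List.map_congr_left (g := id), List.map_id]
  exact fun x hx => hf x (hl.2.1 x hx)

/-- Transport of `Null` along a homeomorphism of compact spaces. -/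
theorem Null.preimage_homeomorph [CompactSpace X] [CompactSpace Y] (e : X ≃ₜ Y) {m : ℕ}
    {C C' : Set Y} (h : Null K m C C') : Null K m (e ⁻¹' C) (e ⁻¹' C') := by
  intro ε hε
  have h1 := Metric.uniformContinuous_iff.1
    (CompactSpace.uniformContinuous_of_continuous e.continuous)
  have h2 := Metric.uniformContinuous_iff.1
    (CompactSpace.uniformContinuous_of_continuous e.symm.continuous)
  obtain ⟨ε', hε', h2⟩ := h2 ε hε
  obtain ⟨δ', hδ', H⟩ := h ε' hε'
  obtain ⟨δ, hδ, h1⟩ := h1 δ' hδ'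
  refine ⟨δ, hδ, fun z hz hz' => ?_⟩
  obtain ⟨w, hw, hwz⟩ := H (pushList K e z)
    (pushList_mem_small e (fun x hx => hx) (fun x _ y _ hxy => h1 hxy) hz)
    (by rw [bdry_pushList, hz', map_zero])
  refine ⟨pushList K e.symm w, pushList_mem_small e.symm (fun x hx => by simpa using hx)
    (fun x _ y _ hxy => h2 hxy) hw, ?_⟩
  rw [bdry_pushList, hwz, pushList_comp]
  exact pushList_eq_self (fun x _ => by simp) hz

theorem prism_mem_small {m : ℕ} {ε δ : ℝ} {C : Set X} {D : Set Y} (f g : X → Y)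
    (hf : Set.MapsTo f C D) (hg : Set.MapsTo g C D)
    (hd : ∀ x ∈ C, ∀ y ∈ C, dist x y < δ → dist (f x) (f y) < ε ∧ dist (f x) (g y) < ε ∧
      dist (g x) (g y) < ε)
    {z : List X →₀ K} (hz : z ∈ small K m δ C) : prism K f g z ∈ small K (m + 1) ε D := by
  refine map_mem_supported _ ?_ hz
  intro l hl
  rw [prism_single]
  refine supported_mono' ?_ (prismList_mem f g l)
  rintro l' ⟨h1, h2⟩
  refine ⟨by rw [h1, hl.1], ?_, ?_⟩
  · intro y hy
    obtain ⟨x, hx, rfl | rfl⟩ := h2 y hy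
    · exact hf (hl.2.1 x hx)
    · exact hg (hl.2.1 x hx)
  · intro y hy y' hy'
    obtain ⟨x, hx, h⟩ := h2 y hy
    obtain ⟨x', hx', h'⟩ := h2 y' hy'
    have e1 := hd x (hl.2.1 x hx) x' (hl.2.1 x' hx') (hl.2.2 x hx x' hx')
    have e2 := hd x' (hl.2.1 x' hx') x (hl.2.1 x hx) (hl.2.2 x' hx' x hx)
    rcases h with rfl | rfl <;> rcases h' with rfl | rfl
    · exact e1.1
    · exact e1.2.1
    · rw [dist_comm]; exact e2.2.1
    · exact e1.2.2

/-- If `C` can be deformed inside `C'` into `D`, and `D` is null in `C'`, so is `C`. -/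
theorem Null.of_homotopy {m : ℕ} {C D C' : Set X} (hC : IsCompact C) (H : ℝ → X → X)
    (hH : ContinuousOn (fun p : ℝ × X => H p.1 p.2) (Set.Icc 0 1 ×ˢ C))
    (h0 : ∀ x ∈ C, H 0 x = x) (h1 : ∀ x ∈ C, H 1 x ∈ D)
    (hC' : ∀ t ∈ Set.Icc (0 : ℝ) 1, ∀ x ∈ C, H t x ∈ C') (hD : Null K m D C') :
    Null K m C C' := by
  intro ε hε
  obtain ⟨ε', hε', hD⟩ := hD ε hε
  have hu := Metric.uniformContinuousOn_iff.1
    ((isCompact_Icc.prod hC).uniformContinuousOn_of_continuous hH) (min ε ε') (lt_min hε hε')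
  obtain ⟨η, hη, hu⟩ := hu
  have hu' : ∀ s ∈ Set.Icc (0 : ℝ) 1, ∀ t ∈ Set.Icc (0 : ℝ) 1, ∀ x ∈ C, ∀ y ∈ C,
      dist s t < η → dist x y < η → dist (H s x) (H t y) < min ε ε' := by
    intro s hs t ht x hx y hy hst hxy
    exact hu (s, x) ⟨hs, hx⟩ (t, y) ⟨ht, hy⟩ (by rw [Prod.dist_eq]; exact max_lt hst hxy)
  obtain ⟨n, hn⟩ := exists_nat_one_div_lt hη
  have hn0 : (0 : ℝ) < n + 1 := by positivity
  refine ⟨η, hη, fun z hz hz' => ?_⟩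
  have hmem : ∀ i : ℕ, i ≤ n + 1 → (i / (n + 1) : ℝ) ∈ Set.Icc (0 : ℝ) 1 := by
    intro i hi
    refine ⟨by positivity, ?_⟩
    rw [div_le_one hn0]
    exact_mod_cast hi
  have key : ∀ i : ℕ, i ≤ n + 1 → ∃ w ∈ small K (m + 1) ε C',
      bdry K w = pushList K (H (i / (n + 1))) z - z := by
    intro i
    induction i with
    | zero =>
      intro _
      refine ⟨0, Submodule.zero_mem _, ?_⟩
      rw [pushList_eq_self (C := C) (by simpa using h0) hz]
      simp
    | succ i ih =>
      intro hi
      obtain ⟨w, hw, hwz⟩ := ih (by omega)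
      have a := hmem i (by omega)
      have b := hmem (i + 1) hi
      refine ⟨w + prism K (H (i / (n + 1))) (H ((i + 1 : ℕ) / (n + 1))) z,
        Submodule.add_mem _ hw (prism_mem_small _ _ (hC' _ a) (hC' _ b) ?_ hz), ?_⟩
      · intro x hx y hy hxy
        have hst : dist (i / (n + 1) : ℝ) ((i + 1 : ℕ) / (n + 1)) < η := by
          rw [dist_comm, Real.dist_eq, ← sub_div]
          push_cast
          rw [add_sub_cancel_left, abs_of_pos (by positivity)]
          exact hn
        exact ⟨(hu' _ a _ a x hx y hy (by simpa using hη) hxy).trans_le (min_le_left _ _),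
          (hu' _ a _ b x hx y hy hst hxy).trans_le (min_le_left _ _),
          (hu' _ b _ b x hx y hy (by simpa using hη) hxy).trans_le (min_le_left _ _)⟩
      · rw [map_add, hwz, bdry_prism, hz', map_zero]
        abel
  obtain ⟨w, hw, hwz⟩ := key (n + 1) le_rfl
  have e1 : ((n + 1 : ℕ) / (n + 1) : ℝ) = 1 := by push_cast; exact div_self hn0.ne'
  rw [e1] at hwz
  have one_mem : (1 : ℝ) ∈ Set.Icc (0 : ℝ) 1 := by simp
  obtain ⟨w', hw', hwz'⟩ := hD (pushList K (H 1) z)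
    (pushList_mem_small _ h1 (fun x hx y hy hxy =>
      (hu' 1 one_mem 1 one_mem x hx y hy (by simpa using hη) hxy).trans_le (min_le_right _ _)) hz)
    (by rw [bdry_pushList, hz', map_zero])
  exact ⟨w' - w, Submodule.sub_mem _ hw' hw, by rw [map_sub, hwz, hwz']; abel⟩

theorem Null.singleton {m : ℕ} {p : X} {C' : Set X} (hp : p ∈ C') : Null K m {p} C' := by
  intro ε hε
  refine ⟨ε, hε, fun z hz hz' => ⟨cone K p z, ?_, by rw [bdry_cone, hz']; simp⟩⟩
  refine map_mem_supported _ ?_ hz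
  intro l hl
  rw [cone_single]
  have : ∀ x ∈ p :: l, x = p := by
    intro x hx
    rcases List.mem_cons.1 hx with rfl | hx
    · rfl
    · exact hl.2.1 x hx
  refine Finsupp.single_mem_supported K 1 ⟨by simp [hl.1], fun x hx => ?_, fun x hx y hy => ?_⟩
  · rw [this x hx]; exact hp
  · rw [this x hx, this y hy]; simpa using hε

theorem Null.zero_of_nonempty {C C' : Set X} (h : C'.Nonempty) : Null K 0 C C' := by
  obtain ⟨p, hp⟩ := h
  intro ε hε
  obtain ⟨δ, hδ, H⟩ := Null.singleton (K := K) (m := 0) hp ε hε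
  refine ⟨δ, hδ, fun z hz => H z (supported_mono' ?_ hz)⟩
  rintro l ⟨h, -⟩
  rw [List.length_eq_zero_iff] at h
  subst h
  exact ⟨rfl, by simp, by simp⟩

theorem exists_split {m : ℕ} {r : ℝ} {B B₁ B₂ : Set X}
    (hB : smallLists m r B ⊆ smallLists m r B₁ ∪ smallLists m r B₂) {z : List X →₀ K}
    (hz : z ∈ small K m r B) :
    ∃ z₁ ∈ small K m r B₁, ∃ z₂ ∈ small K m r B₂, z₁ + z₂ = z := by
  have := supported_mono' hB hz
  rw [Finsupp.supported_union] at this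
  exact Submodule.mem_sup.1 this

/-- A Mayer–Vietoris argument for a space covered by two pieces. -/
theorem Null.union {m : ℕ} {B B₁ B₂ E : Set X} {r : ℝ} (hr : 0 < r)
    (hB : ∀ l ∈ smallLists (m + 1) r B, (∀ x ∈ l, x ∈ B₁) ∨ (∀ x ∈ l, x ∈ B₂))
    (h : Null K m (B₁ ∩ B₂) (B₁ ∩ B₂)) (h₁ : Null K (m + 1) B₁ E) (h₂ : Null K (m + 1) B₂ E) :
    Null K (m + 1) B E := by
  intro ε hε
  obtain ⟨δ₁, hδ₁, h₁⟩ := h₁ ε hε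
  obtain ⟨δ₂, hδ₂, h₂⟩ := h₂ ε hε
  obtain ⟨δ, hδ, h⟩ := h (min δ₁ δ₂) (lt_min hδ₁ hδ₂)
  set ρ := min (min δ₁ δ₂) (min δ r) with hρ
  have hρ1 : ρ ≤ δ₁ := (min_le_left _ _).trans (min_le_left _ _)
  have hρ2 : ρ ≤ δ₂ := (min_le_left _ _).trans (min_le_right _ _)
  have hρ3 : ρ ≤ δ := (min_le_right _ _).trans (min_le_left _ _)
  have hρ4 : ρ ≤ r := (min_le_right _ _).trans (min_le_right _ _)
  refine ⟨ρ, by positivity, fun z hz hz' => ?_⟩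
  obtain ⟨z₁, hz₁, z₂, hz₂, rfl⟩ := exists_split (B₁ := B₁) (B₂ := B₂) (by
    intro l hl
    rcases hB l (smallLists_mono hρ4 subset_rfl hl) with h | h
    · exact Or.inl ⟨hl.1, h, hl.2.2⟩
    · exact Or.inr ⟨hl.1, h, hl.2.2⟩) hz
  rw [map_add] at hz'
  have e : bdry K z₁ = - bdry K z₂ := eq_neg_of_add_eq_zero_left hz'
  obtain ⟨c, hc, hcz⟩ := h (bdry K z₁)
    (small_mono hρ3 subset_rfl (small_inter (bdry_mem_small hz₁)
      (by rw [e]; exact Submodule.neg_mem _ (bdry_mem_small hz₂)))) (bdry_bdry _)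
  obtain ⟨w₁, hw₁, e₁⟩ := h₁ (z₁ - c) (Submodule.sub_mem _ (small_mono hρ1 subset_rfl hz₁)
    (small_mono (min_le_left _ _) Set.inter_subset_left hc)) (by rw [map_sub, hcz, sub_self])
  obtain ⟨w₂, hw₂, e₂⟩ := h₂ (z₂ + c) (Submodule.add_mem _ (small_mono hρ2 subset_rfl hz₂)
    (small_mono (min_le_right _ _) Set.inter_subset_right hc))
    (by rw [map_add, hcz, add_comm]; exact hz')
  exact ⟨w₁ + w₂, Submodule.add_mem _ hw₁ hw₂, by rw [map_add, e₁, e₂]; abel⟩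

end Small

section Complement

variable {K : Type*} [Field K] {X : Type*} [PseudoMetricSpace X]

variable (K) in
/-- Small cycles in `C` with `m` vertices bound in a compact part of the complement of `A`. -/
def NullOff (m : ℕ) (C A : Set X) : Prop :=
  ∃ C', IsClosed C' ∧ Disjoint C' A ∧ Null K m C C'

variable (K) in
/-- The complement of `A` is acyclic in all degrees. -/
def AcyclicCompl (A : Set X) : Prop :=
  ∀ m C, IsClosed C → Disjoint C A → NullOff K m C A

theorem NullOff.mono {m : ℕ} {C A B : Set X} (h : NullOff K m C A) (hB : B ⊆ A) :
    NullOff K m C B := by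
  obtain ⟨C', h1, h2, h3⟩ := h
  exact ⟨C', h1, h2.mono_right hB, h3⟩

variable [CompactSpace X]

/-- A Mayer–Vietoris argument for complements. -/
theorem NullOff.union {m : ℕ} {C A₁ A₂ : Set X} (hA₁ : IsClosed A₁) (hA₂ : IsClosed A₂)
    (h₁ : NullOff K m C A₁) (h₂ : NullOff K m C A₂) (h : AcyclicCompl K (A₁ ∩ A₂)) :
    NullOff K m C (A₁ ∪ A₂) := by
  obtain ⟨C₁, hC₁, hd₁, h₁⟩ := h₁
  obtain ⟨C₂, hC₂, hd₂, h₂⟩ := h₂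
  obtain ⟨D, hD, hdD, h⟩ := h (m + 1) (C₁ ∪ C₂) (hC₁.union hC₂) (by
    rw [Set.disjoint_union_left]
    exact ⟨hd₁.mono_right Set.inter_subset_left, hd₂.mono_right Set.inter_subset_right⟩)
  have hdis : Disjoint (A₁ ∩ D) (A₂ ∩ D) := by
    rw [Set.disjoint_left] at hdD ⊢
    exact fun x hx hx' => hdD hx.2 ⟨hx.1, hx'.1⟩
  obtain ⟨r, hr, hth⟩ := hdis.exists_thickenings (hA₁.inter hD).isCompact (hA₂.inter hD)
  set E₁ := D \ Metric.thickening (r / 2) (A₁ ∩ D) with hE₁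
  set E₂ := D \ Metric.thickening (r / 2) (A₂ ∩ D) with hE₂
  have hE₁A : Disjoint E₁ A₁ := by
    rw [Set.disjoint_left]
    exact fun x hx hx' => hx.2 (Metric.self_subset_thickening (half_pos hr) _ ⟨hx', hx.1⟩)
  have hE₂A : Disjoint E₂ A₂ := by
    rw [Set.disjoint_left]
    exact fun x hx hx' => hx.2 (Metric.self_subset_thickening (half_pos hr) _ ⟨hx', hx.1⟩)
  have hsplit : ∀ l ∈ smallLists (m + 2) (r / 2) D,
      (∀ x ∈ l, x ∈ E₁) ∨ (∀ x ∈ l, x ∈ E₂) := by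
    intro l hl
    by_contra! hcon
    obtain ⟨⟨x, hx, hxE⟩, y, hy, hyE⟩ := hcon
    have hx' : x ∈ Metric.thickening (r / 2) (A₁ ∩ D) := by
      by_contra h'
      exact hxE ⟨hl.2.1 x hx, h'⟩
    have hy' : y ∈ Metric.thickening (r / 2) (A₂ ∩ D) := by
      by_contra h'
      exact hyE ⟨hl.2.1 y hy, h'⟩
    rw [Metric.mem_thickening_iff] at hx'
    obtain ⟨a, ha, hxa⟩ := hx'
    refine Set.disjoint_left.1 hth (?_ : y ∈ _) (Metric.thickening_mono (by linarith) _ hy')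
    rw [Metric.mem_thickening_iff]
    refine ⟨a, ha, ?_⟩
    have := dist_triangle y x a
    have := hl.2.2 y hy x hx
    linarith
  refine ⟨(C₁ ∪ E₁) ∩ (C₂ ∪ E₂), ?_, ?_, ?_⟩
  · exact (hC₁.union (hD.sdiff Metric.isOpen_thickening)).inter
      (hC₂.union (hD.sdiff Metric.isOpen_thickening))
  · rw [Set.disjoint_union_right]
    exact ⟨(hd₁.union_left hE₁A).mono_left Set.inter_subset_left,
      (hd₂.union_left hE₂A).mono_left Set.inter_subset_right⟩
  · intro ε hε
    obtain ⟨δ, hδ, h⟩ := h (min ε (r / 2)) (by positivity)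
    obtain ⟨δ₁, hδ₁, h₁⟩ := h₁ (min ε δ) (by positivity)
    obtain ⟨δ₂, hδ₂, h₂⟩ := h₂ (min ε δ) (by positivity)
    refine ⟨min δ₁ δ₂, by positivity, fun z hz hz' => ?_⟩
    obtain ⟨w₁, hw₁, e₁⟩ := h₁ z (small_mono (min_le_left _ _) subset_rfl hz) hz'
    obtain ⟨w₂, hw₂, e₂⟩ := h₂ z (small_mono (min_le_right _ _) subset_rfl hz) hz'
    obtain ⟨t, ht, et⟩ := h (w₁ - w₂) (Submodule.sub_mem _
      (small_mono (min_le_right _ _) Set.subset_union_left hw₁)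
      (small_mono (min_le_right _ _) Set.subset_union_right hw₂))
      (by rw [map_sub, e₁, e₂, sub_self])
    obtain ⟨t₁, ht₁, t₂, ht₂, rfl⟩ := exists_split (B₁ := E₁) (B₂ := E₂) (by
      intro l hl
      rcases hsplit l (smallLists_mono (min_le_right _ _) subset_rfl hl) with h | h
      · exact Or.inl ⟨hl.1, h, hl.2.2⟩
      · exact Or.inr ⟨hl.1, h, hl.2.2⟩) ht
    rw [map_add] at et
    refine ⟨w₁ - bdry K t₁, small_inter ?_ ?_, by rw [map_sub, e₁, bdry_bdry, sub_zero]⟩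
    · exact Submodule.sub_mem _ (small_mono (min_le_left _ _) Set.subset_union_left hw₁)
        (small_mono (min_le_left _ _) Set.subset_union_right (bdry_mem_small ht₁))
    · have : w₁ - bdry K t₁ = w₂ + bdry K t₂ := by
        rw [sub_eq_iff_eq_add, add_assoc, add_comm (bdry K t₂), et]; abel
      rw [this]
      exact Submodule.add_mem _ (small_mono (min_le_left _ _) Set.subset_union_left hw₂)
        (small_mono (min_le_left _ _) Set.subset_union_right (bdry_mem_small ht₂))

theorem AcyclicCompl.union {A₁ A₂ : Set X} (hA₁ : IsClosed A₁) (hA₂ : IsClosed A₂)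
    (h₁ : AcyclicCompl K A₁) (h₂ : AcyclicCompl K A₂) (h : AcyclicCompl K (A₁ ∩ A₂)) :
    AcyclicCompl K (A₁ ∪ A₂) := fun m C hC hd =>
  NullOff.union hA₁ hA₂ (h₁ m C hC (hd.mono_right Set.subset_union_left))
    (h₂ m C hC (hd.mono_right Set.subset_union_right)) h

/-- A relation on the points of `[a, b]` that is transitive along the interval and holds locally
holds between the endpoints. -/
theorem interval_chain {a b : ℝ} (hab : a ≤ b) (R : ℝ → ℝ → Prop)
    (htrans : ∀ x y z, a ≤ x → x ≤ y → y ≤ z → z ≤ b → R x y → R y z → R x z)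
    (hloc : ∀ t ∈ Set.Icc a b, ∃ η > 0, ∀ x y, x ≤ y → dist x t < η → dist y t < η → R x y) :
    R a b := by
  choose! η hη hR using hloc
  obtain ⟨δ, hδ, hleb⟩ := lebesgue_number_lemma_of_metric (s := Set.Icc a b)
    (c := fun t : Set.Icc a b => Metric.ball (t : ℝ) (η t)) isCompact_Icc
    (fun _ => Metric.isOpen_ball)
    (fun x hx => Set.mem_iUnion.2 ⟨⟨x, hx⟩, Metric.mem_ball_self (hη x hx)⟩)
  have hstep : ∀ x y, x ∈ Set.Icc a b → x ≤ y → dist y x < δ → R x y := by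
    intro x y hx hxy hd
    obtain ⟨t, ht⟩ := hleb x hx
    exact hR t t.2 x y hxy (ht (Metric.mem_ball_self hδ)) (ht hd)
  have key : ∀ n : ℕ, ∀ y, a ≤ y → y ≤ b → y ≤ a + n * (δ / 2) → R a y := by
    intro n
    induction n with
    | zero =>
      intro y h1 h2 h3
      have : y = a := by simp at h3; linarith
      subst this
      exact hstep y y ⟨h1, h2⟩ le_rfl (by simpa using hδ)
    | succ n ih =>
      intro y h1 h2 h3
      have hm1 : a ≤ max a (y - δ / 2) := le_max_left _ _
      have hm2 : max a (y - δ / 2) ≤ y := max_le h1 (by linarith)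
      refine htrans a (max a (y - δ / 2)) y le_rfl hm1 hm2 h2 (ih _ hm1 (hm2.trans h2) ?_) ?_
      · push_cast at h3
        refine max_le ?_ (by linarith)
        have : 0 ≤ n * (δ / 2) := by positivity
        linarith
      · refine hstep _ _ ⟨hm1, hm2.trans h2⟩ hm2 ?_
        rw [Real.dist_eq, abs_of_nonneg (by linarith)]
        have := le_max_right a (y - δ / 2)
        linarith
  obtain ⟨n, hn⟩ := exists_nat_ge ((b - a) / (δ / 2))
  refine key n b hab le_rfl ?_
  rw [div_le_iff₀ (half_pos hδ)] at hn
  linarith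

/-- If the complements of all fibres of `A → [a, b]` are acyclic, so is the complement of `A`. -/
theorem AcyclicCompl.of_fibres {A : Set X} (hA : IsClosed A) {τ : X → ℝ} (hτ : Continuous τ)
    {a b : ℝ} (hab : a ≤ b) (hAτ : ∀ x ∈ A, τ x ∈ Set.Icc a b)
    (h : ∀ t ∈ Set.Icc a b, AcyclicCompl K (A ∩ τ ⁻¹' {t})) : AcyclicCompl K A := by
  intro m C hC hd
  have hAA : A = A ∩ τ ⁻¹' Set.Icc a b := by
    ext x
    exact ⟨fun hx => ⟨hx, hAτ x hx⟩, fun hx => hx.1⟩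
  rw [hAA]
  refine interval_chain hab (fun x y => NullOff K m C (A ∩ τ ⁻¹' Set.Icc x y)) ?_ ?_
  · intro x y z hax hxy hyz hzb h1 h2
    have hcl : ∀ u v, IsClosed (A ∩ τ ⁻¹' Set.Icc u v) := fun u v =>
      hA.inter (isClosed_Icc.preimage hτ)
    have h_interval : A ∩ τ ⁻¹' Set.Icc x y ∩ (A ∩ τ ⁻¹' Set.Icc y z) = A ∩ τ ⁻¹' {y} := by
      rw [← Set.inter_inter_distrib_left, ← Set.preimage_inter,
        Set.Icc_inter_Icc_eq_singleton hxy hyz]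
    have := NullOff.union (hcl x y) (hcl y z) h1 h2
      (by rw [h_interval]; exact h y ⟨hax.trans hxy, hyz.trans hzb⟩)
    rwa [← Set.inter_union_distrib_left, ← Set.preimage_union, Set.Icc_union_Icc_eq_Icc hxy hyz]
      at this
  · intro t ht
    obtain ⟨C', hC', hd', hN⟩ := h t ht m C hC (hd.mono_right Set.inter_subset_left)
    have hcomp : IsCompact (τ '' (C' ∩ A)) := (hC'.inter hA).isCompact.image hτ
    have hnot : t ∉ τ '' (C' ∩ A) := by
      rintro ⟨x, hx, rfl⟩
      exact Set.disjoint_left.1 hd' hx.1 ⟨hx.2, rfl⟩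
    obtain ⟨η, hη, hball⟩ := Metric.isOpen_iff.1 hcomp.isClosed.isOpen_compl t hnot
    refine ⟨η, hη, fun x y hxy hx hy => ⟨C', hC', ?_, hN⟩⟩
    rw [Set.disjoint_left]
    rintro p hp ⟨hpA, hpI⟩
    refine hball (?_ : τ p ∈ Metric.ball t η) ⟨p, ⟨hp, hpA⟩, rfl⟩
    rw [Metric.mem_ball, Real.dist_eq, abs_lt]
    rw [Real.dist_eq, abs_lt] at hx hy
    have := hpI.1
    have := hpI.2
    constructor <;> linarith

end Complement

section Convex

variable {K : Type*} [Field K] {V : Type*} [Fintype V] {R : Set (V → ℝ)}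

open Classical in
/-- In a compact space all of whose points have acyclic complement, compact convex subsets have
acyclic complement. -/
theorem AcyclicCompl.of_convex [CompactSpace R] (hpt : ∀ p : R, AcyclicCompl K {p})
    {A : Set (V → ℝ)} (hAR : A ⊆ R) (hA : IsCompact A) (hne : A.Nonempty) (hconv : Convex ℝ A) :
    AcyclicCompl K ((↑) ⁻¹' A : Set R) := by
  obtain ⟨n, hn⟩ : ∃ n, n = (Finset.univ.filter fun v => ¬ ∀ x ∈ A, ∀ y ∈ A, x v = y v).card :=
    ⟨_, rfl⟩
  induction n using Nat.strong_induction_on generalizing A with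
  | _ n ih =>
  by_cases hall : ∀ v, ∀ x ∈ A, ∀ y ∈ A, x v = y v
  · obtain ⟨p, hp⟩ := hne
    have : ((↑) ⁻¹' A : Set R) = {⟨p, hAR hp⟩} := by
      ext q
      simp only [Set.mem_preimage, Set.mem_singleton_iff, Subtype.ext_iff]
      refine ⟨fun hq => funext fun v => hall v _ hq _ hp, fun hq => by rw [hq]; exact hp⟩
    rw [this]
    exact hpt _
  · push Not at hall
    obtain ⟨v, hv⟩ := hall
    have himg : IsCompact ((fun x : V → ℝ => x v) '' A) := hA.image (continuous_apply v)
    have hpre : IsConnected ((fun x : V → ℝ => x v) '' A) :=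
      (hconv.isConnected hne).image _ (continuous_apply v).continuousOn
    have hI := eq_Icc_of_connected_compact hpre himg
    set a := sInf ((fun x : V → ℝ => x v) '' A)
    set b := sSup ((fun x : V → ℝ => x v) '' A)
    have hab : a ≤ b := by
      rw [← Set.nonempty_Icc, ← hI]
      exact hne.image _
    refine AcyclicCompl.of_fibres (hA.isClosed.preimage continuous_subtype_val)
      (τ := fun x : R => (x : V → ℝ) v) ((continuous_apply v).comp continuous_subtype_val) hab ?_ ?_
    · intro x hx
      rw [← hI]
      exact ⟨x, hx, rfl⟩
    · intro t ht
      have hfib : ((↑) ⁻¹' A ∩ (fun x : R => (x : V → ℝ) v) ⁻¹' {t} : Set R) =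
          (↑) ⁻¹' (A ∩ {x | x v = t}) := rfl
      rw [hfib]
      rw [← hI] at ht
      obtain ⟨p, hp, hpt'⟩ := ht
      refine ih _ ?_ (Set.inter_subset_left.trans hAR)
        (hA.inter_right (isClosed_eq (continuous_apply v) continuous_const)) ⟨p, hp, hpt'⟩
        (hconv.inter ?_) rfl
      · rw [hn]
        refine Finset.card_lt_card ?_
        rw [Finset.ssubset_iff_of_subset]
        · refine ⟨v, ?_, ?_⟩
          · simpa using hv
          · simp only [Finset.mem_filter, Finset.mem_univ, true_and, not_not]
            intro x hx y hy
            rw [hx.2, hy.2]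
        · intro w hw
          simp only [Finset.mem_filter, Finset.mem_univ, true_and] at hw ⊢
          exact fun h => hw fun x hx y hy => h x hx.1 y hy.1
      · intro x hx y hy c d _ _ hcd
        simp only [Set.mem_ofPred_eq] at hx hy
        simp only [Set.mem_ofPred_eq, Pi.add_apply, Pi.smul_apply, hx, hy, smul_eq_mul]
        rw [← add_mul, hcd, one_mul]

/-- A finite union of compact convex sets with a common point has acyclic complement. -/
theorem AcyclicCompl.of_iUnion_convex [CompactSpace R] (hpt : ∀ p : R, AcyclicCompl K {p})
    {ι : Type*} (s : Finset ι) (hs : s.Nonempty) (A : ι → Set (V → ℝ)) {p : V → ℝ}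
    (hAR : ∀ i ∈ s, A i ⊆ R) (hA : ∀ i ∈ s, IsCompact (A i)) (hp : ∀ i ∈ s, p ∈ A i)
    (hconv : ∀ i ∈ s, Convex ℝ (A i)) :
    AcyclicCompl K ((↑) ⁻¹' (⋃ i ∈ s, A i) : Set R) := by
  induction hs using Finset.Nonempty.cons_induction generalizing A with
  | singleton i =>
    simp only [Finset.mem_singleton, forall_eq] at *
    simpa using AcyclicCompl.of_convex hpt hAR hA ⟨p, hp⟩ hconv
  | cons i s hi hs ih =>
    simp only [Finset.mem_cons, forall_eq_or_imp] at hAR hA hp hconv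
    have e : (⋃ j ∈ Finset.cons i s hi, A j) = A i ∪ ⋃ j ∈ s, A j := by
      ext x; simp
    rw [e, Set.preimage_union]
    refine AcyclicCompl.union (hA.1.isClosed.preimage continuous_subtype_val)
      ((s.finite_toSet.isCompact_biUnion hA.2).isClosed.preimage continuous_subtype_val)
      (AcyclicCompl.of_convex hpt hAR.1 hA.1 ⟨p, hp.1⟩ hconv.1)
      (ih A hAR.2 hA.2 hp.2 hconv.2) ?_
    rw [← Set.preimage_inter, Set.inter_iUnion₂]
    exact ih (fun j => A i ∩ A j) (fun j hj => Set.inter_subset_left.trans hAR.1)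
      (fun j hj => hA.1.inter (hA.2 j hj)) (fun j hj => ⟨hp.1, hp.2 j hj⟩)
      (fun j hj => hconv.1.inter (hconv.2 j hj))

end Convex

section Transport

variable {K : Type*} [Field K] {X Y : Type*} [PseudoMetricSpace X] [PseudoMetricSpace Y]
  [CompactSpace X] [CompactSpace Y]

theorem AcyclicCompl.preimage_homeomorph (e : X ≃ₜ Y) {A : Set Y} (h : AcyclicCompl K A) :
    AcyclicCompl K (e ⁻¹' A) := by
  intro m C hC hd
  obtain ⟨C', h1, h2, h3⟩ := h m (e.symm ⁻¹' C) (hC.preimage e.symm.continuous) (by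
    rw [Set.disjoint_left] at hd ⊢
    exact fun y hy hy' => hd hy (by simpa using hy'))
  refine ⟨e ⁻¹' C', h1.preimage e.continuous, h2.preimage e, ?_⟩
  have := h3.preimage_homeomorph e
  rwa [← Set.preimage_comp, e.symm_comp_self, Set.preimage_id] at this

end Transport

section Sphere

variable {K : Type*} [Field K] {E : Type*} [NormedAddCommGroup E] [NormedSpace ℝ E]

local notation "𝕊" => Metric.sphere (0 : E) 1

open Classical in
/-- The radial projection of `v` to the unit sphere, with a default value for `v = 0`. -/
noncomputable def radial (v : E) (x : 𝕊) : 𝕊 :=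
  if h : v = 0 then x else ⟨‖v‖⁻¹ • v, by
    simp [norm_smul, inv_mul_cancel₀ (norm_ne_zero_iff.2 h)]⟩

theorem coe_radial {v : E} (h : v ≠ 0) (x : 𝕊) : (radial v x : E) = ‖v‖⁻¹ • v := by
  simp [radial, h]

theorem radial_coe (x y : 𝕊) : radial (x : E) y = x := by
  have hx : ‖(x : E)‖ = 1 := by simp
  have : (x : E) ≠ 0 := by
    intro h
    rw [h, norm_zero] at hx
    exact zero_ne_one hx
  ext
  rw [coe_radial this, hx]
  simp

theorem continuousOn_radial {Z : Type*} [TopologicalSpace Z] {G : Z → E} {g : Z → 𝕊} {S : Set Z}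
    (hG : ContinuousOn G S) (h0 : ∀ z ∈ S, G z ≠ 0) :
    ContinuousOn (fun z => radial (G z) (g z)) S := by
  rw [Topology.IsInducing.subtypeVal.continuousOn_iff]
  refine ContinuousOn.congr (f := fun z => ‖G z‖⁻¹ • G z) ?_ (fun z hz => coe_radial (h0 z hz) _)
  exact (hG.norm.inv₀ fun z hz => norm_ne_zero_iff.2 (h0 z hz)).smul hG

theorem segment_eq_neg {x p : 𝕊} {t c : ℝ} (ht : t ∈ Set.Icc (0 : ℝ) 1) (hc : 0 ≤ c)
    (h : (1 - t) • (x : E) + t • (p : E) = - (c • (p : E))) : (x : E) = - p := by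
  have hx : ‖(x : E)‖ = 1 := by simp
  have hp : ‖(p : E)‖ = 1 := by simp
  have h' : (1 - t) • (x : E) = - ((c + t) • (p : E)) := by
    rw [add_smul, neg_add, ← h]
    abel
  have hn := congrArg norm h'
  rw [norm_neg, norm_smul, norm_smul, hx, hp, Real.norm_of_nonneg (by linarith [ht.2]),
    Real.norm_of_nonneg (by linarith [ht.1]), mul_one, mul_one] at hn
  rw [← hn, ← smul_neg] at h'
  have hne : (1 - t : ℝ) ≠ 0 := by
    intro h
    linarith [ht.1]
  exact smul_right_injective E hne h'

theorem segment_ne_zero {x p : 𝕊} {t : ℝ} (ht : t ∈ Set.Icc (0 : ℝ) 1) (hx : (x : E) ≠ - p) :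
    (1 - t) • (x : E) + t • (p : E) ≠ 0 := by
  intro h
  exact hx (segment_eq_neg ht le_rfl (by rw [h]; simp))

theorem continuousOn_segment {p : 𝕊} {C : Set 𝕊} (hp : ∀ x ∈ C, (x : E) ≠ - p) :
    ContinuousOn (fun q : ℝ × 𝕊 => radial ((1 - q.1) • (q.2 : E) + q.1 • (p : E)) q.2)
      (Set.Icc 0 1 ×ˢ C) := by
  refine continuousOn_radial (Continuous.continuousOn (by fun_prop)) ?_
  rintro ⟨t, x⟩ ⟨ht, hx⟩
  exact segment_ne_zero ht (hp x hx)

theorem Null.of_segment {m : ℕ} {C C' : Set 𝕊} (hC : IsCompact C) {p : 𝕊} (hpC : p ∈ C')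
    (hp : ∀ x ∈ C, (x : E) ≠ - p)
    (hC' : ∀ t ∈ Set.Icc (0 : ℝ) 1, ∀ x ∈ C, radial ((1 - t) • (x : E) + t • (p : E)) x ∈ C') :
    Null K m C C' := by
  refine Null.of_homotopy (D := {p}) hC (fun t x => radial ((1 - t) • (x : E) + t • (p : E)) x)
    (continuousOn_segment hp) ?_ ?_ hC' (Null.singleton hpC)
  · intro x _
    simp [radial_coe]
  · intro x _
    simp [radial_coe]

theorem acyclicCompl_point_sphere [FiniteDimensional ℝ E] (q : 𝕊) :
    AcyclicCompl K ({q} : Set 𝕊) := by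
  have : ProperSpace E := FiniteDimensional.proper ℝ E
  intro m C hC hd
  set p : 𝕊 := -q with hp
  have hpq : (p : E) = - q := rfl
  have hCp : ∀ x ∈ C, (x : E) ≠ - p := by
    intro x hx h
    rw [hpq, neg_neg] at h
    exact Set.disjoint_left.1 hd hx (Subtype.ext h)
  refine ⟨(fun r : ℝ × 𝕊 => radial ((1 - r.1) • (r.2 : E) + r.1 • (p : E)) r.2) ''
    (Set.Icc 0 1 ×ˢ C) ∪ {p}, ?_, ?_, ?_⟩
  · exact ((isCompact_Icc.prod hC.isCompact).image_of_continuousOn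
      (continuousOn_segment hCp)).isClosed.union isClosed_singleton
  · rw [Set.disjoint_singleton_right]
    rintro (⟨⟨t, x⟩, ⟨ht, hx⟩, h⟩ | h)
    · have hne := segment_ne_zero ht (hCp x hx)
      have h' := congrArg (Subtype.val) h
      simp only at h'
      rw [coe_radial hne] at h'
      refine hCp x hx (segment_eq_neg ht
        (norm_nonneg ((1 - t) • (x : E) + t • (p : E))) ?_)
      have hq : -(‖(1 - t) • (x : E) + t • (p : E)‖ • (p : E)) =
          ‖(1 - t) • (x : E) + t • (p : E)‖ • (q : E) := by rw [hpq, smul_neg, neg_neg]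
      rw [hq, ← h', smul_smul, mul_inv_cancel₀ (norm_ne_zero_iff.2 hne), one_smul]
    · have h' : (q : E) = - q := by
        rw [← hpq]
        exact congrArg Subtype.val h
      have hq : ‖(q : E)‖ = 1 := by simp
      have h2 : (2 : ℝ) • (q : E) = 0 := by
        rw [two_smul]
        nth_rw 2 [h']
        exact add_neg_cancel _
      rw [(smul_eq_zero.1 h2).resolve_left two_ne_zero, norm_zero] at hq
      exact zero_ne_one hq
  · refine Null.of_segment hC.isCompact (Or.inr rfl) hCp ?_
    intro t ht x hx
    exact Or.inl ⟨(t, x), ⟨ht, hx⟩, rfl⟩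

end Sphere

section CoordinateSphere

variable {K : Type*} [Field K] {d : ℕ}

local notation "𝕊" => Metric.sphere (0 : EuclideanSpace ℝ (Fin d)) 1

/-- The points of the unit sphere whose coordinates outside `s` vanish. -/
def coordSphere (s : Finset (Fin d)) : Set 𝕊 :=
  {x | ∀ i ∉ s, (x : EuclideanSpace ℝ (Fin d)) i = 0}

theorem radial_mem_coordSphere {s : Finset (Fin d)} {v : EuclideanSpace ℝ (Fin d)} {x : 𝕊}
    (hx : x ∈ coordSphere s) (hv : ∀ i ∉ s, v i = 0) : radial v x ∈ coordSphere s := by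
  by_cases h : v = 0
  · simpa [radial, h] using hx
  · intro i hi
    rw [coe_radial h]
    simp [hv i hi]

theorem isClosed_coordSphere (s : Finset (Fin d)) : IsClosed (coordSphere s) := by
  simp only [coordSphere, Set.ofPred_forall]
  exact isClosed_iInter fun i => isClosed_iInter fun _ => isClosed_eq (by fun_prop) (by fun_prop)

/-- The sphere spanned by `s` has no reduced homology below its top degree. -/
theorem null_coordSphere (s : Finset (Fin d)) (m : ℕ) (hm : m + 1 ≤ s.card) :
    Null K m (coordSphere s) (coordSphere s) := by
  induction s using Finset.induction_on generalizing m with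
  | empty => simp at hm
  | insert u s hu ih =>
    rw [Finset.card_insert_of_notMem hu] at hm
    set e : 𝕊 := ⟨EuclideanSpace.single u 1, by simp⟩ with he
    have hev : (e : EuclideanSpace ℝ (Fin d)) = EuclideanSpace.single u 1 := rfl
    have heS : e ∈ coordSphere (insert u s) := by
      intro i hi
      rw [Finset.mem_insert, not_or] at hi
      simp [hev, hi.1]
    have hneS : -e ∈ coordSphere (insert u s) := by
      intro i hi
      simpa using heS i hi
    have hseg : ∀ p ∈ coordSphere (insert u s), ∀ t ∈ Set.Icc (0 : ℝ) 1,
        ∀ x ∈ coordSphere (insert u s),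
        radial ((1 - t) • (x : EuclideanSpace ℝ (Fin d)) + t • (p : EuclideanSpace ℝ (Fin d))) x ∈
          coordSphere (insert u s) := by
      intro p hp t ht x hx
      refine radial_mem_coordSphere hx fun i hi => ?_
      simp [hx i hi, hp i hi]
    cases m with
    | zero => exact Null.zero_of_nonempty ⟨e, heS⟩
    | succ m =>
      have hcl := isClosed_coordSphere (insert u s)
      have hcont : Continuous fun x : 𝕊 => (x : EuclideanSpace ℝ (Fin d)) u := by fun_prop
      refine Null.union (r := 1 / 2) (by norm_num)
        (B₁ := coordSphere (insert u s) ∩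
          {x | -(1 / 2) ≤ (x : EuclideanSpace ℝ (Fin d)) u})
        (B₂ := coordSphere (insert u s) ∩
          {x | (x : EuclideanSpace ℝ (Fin d)) u ≤ 1 / 2}) ?_ ?_ ?_ ?_
      · intro l hl
        by_contra! hcon
        obtain ⟨⟨x, hx, hxB⟩, y, hy, hyB⟩ := hcon
        have h1 : (x : EuclideanSpace ℝ (Fin d)) u < -(1 / 2) := by
          by_contra! h
          exact hxB ⟨hl.2.1 x hx, h⟩
        have h2 : 1 / 2 < (y : EuclideanSpace ℝ (Fin d)) u := by
          by_contra! h
          exact hyB ⟨hl.2.1 y hy, h⟩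
        have h3 := hl.2.2 x hx y hy
        have h4 := PiLp.dist_apply_le (x : EuclideanSpace ℝ (Fin d)) y u
        rw [Real.dist_eq, abs_sub_comm] at h4
        have h5 := le_abs_self ((y : EuclideanSpace ℝ (Fin d)) u - (x : EuclideanSpace ℝ (Fin d)) u)
        rw [Subtype.dist_eq] at h3
        linarith
      · set G : ℝ → 𝕊 → EuclideanSpace ℝ (Fin d) := fun t x =>
          (x : EuclideanSpace ℝ (Fin d)) -
            (t * (x : EuclideanSpace ℝ (Fin d)) u) • EuclideanSpace.single u (1 : ℝ) with hG
        have hGu : ∀ t x, G t x u = (1 - t) * (x : EuclideanSpace ℝ (Fin d)) u := by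
          intro t x
          simp [hG]
          ring
        have hGi : ∀ t x i, i ≠ u → G t x i = (x : EuclideanSpace ℝ (Fin d)) i := by
          intro t x i hi
          simp [hG, hi]
        have hG0 : ∀ t, ∀ x : 𝕊, |(x : EuclideanSpace ℝ (Fin d)) u| ≤ 1 / 2 → G t x ≠ 0 := by
          intro t x hx h
          have : (x : EuclideanSpace ℝ (Fin d)) =
              EuclideanSpace.single u ((x : EuclideanSpace ℝ (Fin d)) u) := by
            ext i
            by_cases hi : i = u
            · subst hi; simp
            · rw [← hGi t x i hi, h]; simp [hi]
          have h1 : ‖(x : EuclideanSpace ℝ (Fin d))‖ = 1 := by simp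
          rw [this, PiLp.norm_single, Real.norm_eq_abs] at h1
          linarith
        have hnorm : ∀ t ∈ Set.Icc (0 : ℝ) 1, ∀ x : 𝕊,
            |(x : EuclideanSpace ℝ (Fin d)) u| ≤ 1 / 2 →
            |(radial (G t x) x : EuclideanSpace ℝ (Fin d)) u| ≤ 1 / 2 := by
          intro t ht x hx
          have hpos := norm_pos_iff.2 (hG0 t x hx)
          rw [coe_radial (hG0 t x hx), PiLp.smul_apply, hGu, smul_eq_mul, abs_mul, abs_inv,
            abs_norm, inv_mul_le_iff₀ hpos, abs_mul, abs_of_nonneg (by linarith [ht.2])]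
          have h1 : ‖(x : EuclideanSpace ℝ (Fin d))‖ = 1 := by simp
          have h2 : ‖(x : EuclideanSpace ℝ (Fin d))‖ ≤
              ‖G t x‖ + t * |(x : EuclideanSpace ℝ (Fin d)) u| := by
            have e1 : (x : EuclideanSpace ℝ (Fin d)) = G t x +
                (t * (x : EuclideanSpace ℝ (Fin d)) u) • EuclideanSpace.single u (1 : ℝ) := by
              simp [hG]
            have e2 := norm_add_le (G t x)
              ((t * (x : EuclideanSpace ℝ (Fin d)) u) • EuclideanSpace.single u (1 : ℝ))
            rw [← e1] at e2
            refine e2.trans_eq ?_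
            rw [norm_smul, PiLp.norm_single, norm_one, mul_one, Real.norm_eq_abs, abs_mul,
              abs_of_nonneg ht.1]
          nlinarith [ht.1, ht.2]
        refine Null.of_homotopy (D := coordSphere s)
          (((hcl.inter (isClosed_le continuous_const hcont)).inter
            (hcl.inter (isClosed_le hcont continuous_const))).isCompact)
          (fun t x => radial (G t x) x) ?_ ?_ ?_ ?_ ?_
        · refine continuousOn_radial (Continuous.continuousOn (by fun_prop)) ?_
          rintro ⟨t, x⟩ ⟨_, h1, h2⟩
          exact hG0 t x (abs_le.2 ⟨h1.2, h2.2⟩)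
        · intro x _
          simp [hG, radial_coe]
        · rintro x ⟨h1, h2⟩ i hi
          rw [coe_radial (hG0 1 x (abs_le.2 ⟨h1.2, h2.2⟩))]
          by_cases hiu : i = u
          · subst hiu; simp [hGu]
          · simp [hGi _ _ i hiu, h1.1 i (by simp [hiu, hi])]
        · rintro t ht x ⟨h1, h2⟩
          have h3 := abs_le.1 (hnorm t ht x (abs_le.2 ⟨h1.2, h2.2⟩))
          have h4 : radial (G t x) x ∈ coordSphere (insert u s) := by
            refine radial_mem_coordSphere h1.1 fun i hi => ?_
            have hiu : i ≠ u := by rintro rfl; simp at hi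
            rw [hGi _ _ i hiu, h1.1 i hi]
          exact ⟨⟨h4, h3.1⟩, h4, h3.2⟩
        · refine (ih m (by omega)).mono subset_rfl ?_
          intro x hx
          have hxS : x ∈ coordSphere (insert u s) := fun i hi => hx i fun h => hi (by simp [h])
          have hxu := hx u hu
          refine ⟨⟨hxS, ?_⟩, hxS, ?_⟩ <;> simp [hxu]
      · refine Null.of_segment (p := e)
          (hcl.inter (isClosed_le continuous_const hcont)).isCompact heS ?_ ?_
        · rintro x ⟨_, hx⟩ h
          rw [Set.mem_ofPred_eq, h, hev] at hx
          norm_num at hx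
        · exact fun t ht x hx => hseg e heS t ht x hx.1
      · refine Null.of_segment (p := -e)
          (hcl.inter (isClosed_le hcont continuous_const)).isCompact hneS ?_ ?_
        · rintro x ⟨_, hx⟩ h
          have h' : (x : EuclideanSpace ℝ (Fin d)) = EuclideanSpace.single u 1 := by
            rw [h]; simp [hev]
          rw [Set.mem_ofPred_eq, h'] at hx
          norm_num at hx
        · exact fun t ht x hx => hseg (-e) hneS t ht x hx.1

end CoordinateSphere

section Oriented

variable {K : Type*} [Field K] {V : Type*} [LinearOrder V]

variable (K) in
/-- The incidence sign of `v` relative to `σ`. -/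
def faceSign (σ : Finset V) (v : V) : K := (-1) ^ (σ.filter (fun w => w < v)).card

theorem faceSign_mul_self (σ : Finset V) (v : V) : faceSign K σ v * faceSign K σ v = 1 := by
  rw [faceSign, ← mul_pow]
  simp

theorem faceSign_erase_self (σ : Finset V) (v : V) :
    faceSign K (σ.erase v) v = faceSign K σ v := by
  rw [faceSign, faceSign, Finset.filter_erase, Finset.erase_eq_of_notMem (by simp)]

theorem faceSign_insert_self (σ : Finset V) (v : V) :
    faceSign K (insert v σ) v = faceSign K σ v := by
  rw [faceSign, faceSign, Finset.filter_insert, if_neg (lt_irrefl v)]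

theorem faceSign_swap {σ : Finset V} {v w : V} (hv : v ∉ σ) (hw : w ∈ σ) :
    faceSign K σ v * faceSign K (insert v σ) w =
      - (faceSign K σ w * faceSign K (σ.erase w) v) := by
  have hvw : v ≠ w := by rintro rfl; exact hv hw
  simp only [faceSign, Finset.filter_insert, Finset.filter_erase]
  rcases lt_or_gt_of_ne hvw with h | h
  · rw [if_pos h, Finset.card_insert_of_notMem (by simp [hv]),
      Finset.erase_eq_of_notMem (s := σ.filter (· < v)) (by simp [h.le])]
    ring
  · rw [if_neg h.not_gt]
    have hmem : w ∈ σ.filter (· < v) := by simp [hw, h]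
    rw [← Finset.card_erase_add_one hmem]
    ring

variable (K) in
/-- The oriented boundary of a finite set of vertices. -/
noncomputable def faceBdryFinset (σ : Finset V) : Finset V →₀ K :=
  ∑ v ∈ σ, Finsupp.single (σ.erase v) (faceSign K σ v)

variable (K) in
/-- The boundary operator on oriented chains of the full simplex on `V`. -/
noncomputable def faceBdry : (Finset V →₀ K) →ₗ[K] (Finset V →₀ K) :=
  Finsupp.linearCombination K (faceBdryFinset K)

theorem faceBdry_single (σ : Finset V) :
    faceBdry K (Finsupp.single σ 1) = ∑ v ∈ σ, Finsupp.single (σ.erase v) (faceSign K σ v) := by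
  simp [faceBdry, faceBdryFinset]

theorem faceBdry_mem (σ : Finset V) : faceBdry K (Finsupp.single σ 1) ∈
    Finsupp.supported K K {τ : Finset V | τ ⊆ σ ∧ τ.card + 1 = σ.card} := by
  rw [faceBdry_single]
  exact Submodule.sum_mem _ fun v hv => Finsupp.single_mem_supported K _
    ⟨Finset.erase_subset v σ, Finset.card_erase_add_one hv⟩

variable (K) in
/-- The oriented cone with apex `v`. -/
noncomputable def faceCone (v : V) : (Finset V →₀ K) →ₗ[K] (Finset V →₀ K) :=
  Finsupp.linearCombination K fun σ =>
    if v ∈ σ then 0 else Finsupp.single (insert v σ) (faceSign K σ v)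

theorem faceCone_single_of_mem {σ : Finset V} {v : V} (h : v ∈ σ) (a : K) :
    faceCone K v (Finsupp.single σ a) = 0 := by
  simp [faceCone, h]

theorem faceCone_single_of_notMem {σ : Finset V} {v : V} (h : v ∉ σ) (a : K) :
    faceCone K v (Finsupp.single σ a) = Finsupp.single (insert v σ) (a * faceSign K σ v) := by
  simp [faceCone, h]

theorem faceBdry_faceCone (v : V) (c : Finset V →₀ K) :
    faceBdry K (faceCone K v c) = c - faceCone K v (faceBdry K c) := by
  have : (faceBdry K).comp (faceCone K v) =
      LinearMap.id - (faceCone K v).comp (faceBdry K) := by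
    refine Finsupp.lhom_ext' fun σ => LinearMap.ext_ring ?_
    simp only [LinearMap.comp_apply, Finsupp.lsingle_apply, LinearMap.sub_apply,
      LinearMap.id_apply]
    rw [faceBdry_single, map_sum]
    by_cases h : v ∈ σ
    · rw [faceCone_single_of_mem h, map_zero, Finset.sum_eq_single_of_mem v h,
        faceCone_single_of_notMem (Finset.notMem_erase v σ), Finset.insert_erase h,
        faceSign_erase_self, faceSign_mul_self, sub_self]
      intro w _ hwv
      exact faceCone_single_of_mem (Finset.mem_erase.2 ⟨hwv.symm, h⟩) _
    · rw [faceCone_single_of_notMem h, one_mul, ← mul_one (faceSign K σ v), ← smul_eq_mul,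
        ← Finsupp.smul_single, map_smul, faceBdry_single, Finset.sum_insert h,
        Finset.erase_insert h, faceSign_insert_self, smul_add, Finsupp.smul_single, smul_eq_mul,
        faceSign_mul_self, sub_eq_add_neg, ← Finset.sum_neg_distrib, Finset.smul_sum]
      congr 1
      refine Finset.sum_congr rfl fun w hw => ?_
      have hvw : v ≠ w := by rintro rfl; exact h hw
      rw [faceCone_single_of_notMem (fun h' => h (Finset.mem_of_mem_erase h')),
        Finsupp.smul_single, smul_eq_mul, faceSign_swap h hw, Finset.erase_insert_of_ne hvw,
        Finsupp.single_neg]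
  exact LinearMap.congr_fun this c

theorem faceBdry_faceBdry (c : Finset V →₀ K) : faceBdry K (faceBdry K c) = 0 := by
  have : (faceBdry K).comp (faceBdry K) = (0 : (Finset V →₀ K) →ₗ[K] (Finset V →₀ K)) := by
    refine Finsupp.lhom_ext' fun σ => LinearMap.ext_ring ?_
    simp only [LinearMap.comp_apply, Finsupp.lsingle_apply, LinearMap.zero_apply]
    induction σ using Finset.induction_on with
    | empty => simp [faceBdry_single]
    | insert v σ hv ih =>
      have : Finsupp.single (insert v σ) (1 : K) =
          faceSign K σ v • faceCone K v (Finsupp.single σ 1) := by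
        rw [faceCone_single_of_notMem hv, one_mul, Finsupp.smul_single, smul_eq_mul,
          faceSign_mul_self]
      rw [this, map_smul, map_smul, faceBdry_faceCone, map_sub, faceBdry_faceCone, ih]
      simp
  exact LinearMap.congr_fun this c

variable (K) in
/-- The oriented simplex spanned by a list of vertices; zero if the list has a repetition. -/
noncomputable def orientList : List V → (Finset V →₀ K)
  | [] => Finsupp.single ∅ 1
  | v :: t => faceCone K v (orientList t)

variable (K) in
/-- The comparison map from ordered to oriented chains. -/
noncomputable def orient : (List V →₀ K) →ₗ[K] (Finset V →₀ K) :=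
  Finsupp.linearCombination K (orientList K)

theorem orient_single (l : List V) : orient K (Finsupp.single l 1) = orientList K l := by
  simp [orient]

theorem orient_cone (v : V) (c : List V →₀ K) :
    orient K (cone K v c) = faceCone K v (orient K c) := by
  have : (orient K).comp (cone K v) = (faceCone K v).comp (orient K) := by
    refine Finsupp.lhom_ext' fun l => LinearMap.ext_ring ?_
    simp [orient_single, orientList]
  exact LinearMap.congr_fun this c

theorem faceBdry_orient (c : List V →₀ K) : faceBdry K (orient K c) = orient K (bdry K c) := by
  have : (faceBdry K).comp (orient (V := V) K) = (orient K).comp (bdry K) := by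
    refine Finsupp.lhom_ext' fun l => LinearMap.ext_ring ?_
    simp only [LinearMap.comp_apply, Finsupp.lsingle_apply]
    induction l with
    | nil => simp [orient_single, orientList, faceBdry_single]
    | cons v t ih =>
      rw [orient_single, orientList, faceBdry_faceCone, ← orient_single, ih, bdry_cons, map_sub,
        orient_cone]
  exact LinearMap.congr_fun this c

theorem orientList_mem (l : List V) : orientList K l ∈
    Finsupp.supported K K {τ : Finset V | (∀ v, v ∈ τ ↔ v ∈ l) ∧ τ.card = l.length} := by
  induction l with
  | nil =>
    rw [orientList]
    exact Finsupp.single_mem_supported K _ (by simp)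
  | cons v t ih =>
    rw [orientList]
    refine map_mem_supported _ ?_ ih
    rintro τ ⟨h1, h2⟩
    by_cases h : v ∈ τ
    · rw [faceCone_single_of_mem h]
      exact Submodule.zero_mem _
    · rw [faceCone_single_of_notMem h]
      refine Finsupp.single_mem_supported K _ ⟨fun w => by simp [h1], ?_⟩
      rw [Finset.card_insert_of_notMem h, h2, List.length_cons]

end Oriented

section Realization

variable {K : Type*} [Field K] {V : Type} [Fintype V] {P : ASC V}

/-- The part of the realization of `P` supported on the vertices in `σ`. -/
def supportedOn (P : ASC V) (σ : Finset V) : Set P.realization :=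
  {x | ∀ v ∉ σ, (x : V → ℝ) v = 0}

theorem supportedOn_mono {σ τ : Finset V} (h : σ ⊆ τ) : supportedOn P σ ⊆ supportedOn P τ :=
  fun _ hx v hv => hx v fun h' => hv (h h')

theorem isClosed_supportedOn (σ : Finset V) : IsClosed (supportedOn P σ) := by
  simp only [supportedOn, Set.ofPred_forall]
  exact isClosed_iInter fun i => isClosed_iInter fun _ => isClosed_eq
    ((continuous_apply i).comp continuous_subtype_val) continuous_const

/-- The closed simplex on the vertices in `σ`. -/
def closedSimplex (σ : Finset V) : Set (V → ℝ) :=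
  {x | x ∈ stdSimplex ℝ V ∧ ∀ v ∉ σ, x v = 0}

theorem isCompact_closedSimplex (σ : Finset V) : IsCompact (closedSimplex σ) := by
  refine (isCompact_stdSimplex ℝ V).inter_right (t := {x | ∀ v ∉ σ, x v = 0}) ?_
  simp only [Set.ofPred_forall]
  exact isClosed_iInter fun i => isClosed_iInter fun _ => isClosed_eq
    (continuous_apply i) continuous_const

theorem convex_closedSimplex (σ : Finset V) : Convex ℝ (closedSimplex σ) := by
  refine (convex_stdSimplex ℝ V).inter (t := {x | ∀ v ∉ σ, x v = 0}) ?_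
  intro x hx y hy a b _ _ _ v hv
  simp [hx v hv, hy v hv]

open Classical in
theorem closedSimplex_subset_realization {σ : Finset V} (hσ : σ ∈ P.faces) :
    closedSimplex σ ⊆ P.realization := by
  intro x hx
  refine ⟨hx.1.1, hx.1.2, Finset.univ.filter (fun v => x v ≠ 0), P.down_closed hσ ?_, by simp⟩
  intro v hv
  by_contra h
  exact (Finset.mem_filter.1 hv).2 (hx.2 v h)

theorem coe_mem_stdSimplex (x : P.realization) : (x : V → ℝ) ∈ stdSimplex ℝ V :=
  ⟨x.2.1, x.2.2.1⟩

theorem exists_pos (x : P.realization) : ∃ v, 0 < (x : V → ℝ) v := by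
  by_contra! h
  have h1 := x.2.2.1
  have : ∑ v, (x : V → ℝ) v ≤ 0 := Finset.sum_nonpos fun v _ => h v
  linarith

/-- Positivity sets of points of the realization are faces. -/
theorem mem_faces_of_pos (x : P.realization) {τ : Finset V} (h : ∀ v ∈ τ, 0 < (x : V → ℝ) v) :
    τ ∈ P.faces := by
  obtain ⟨ρ, hρ, hx⟩ := x.2.2.2
  exact P.down_closed hρ fun v hv => (hx v).1 (h v hv).ne'

theorem single_mem_closedSimplex [DecidableEq V] {σ : Finset V} {v : V} (hv : v ∈ σ) :
    (Pi.single v 1 : V → ℝ) ∈ closedSimplex σ := by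
  refine ⟨single_mem_stdSimplex ℝ v, fun w hw => ?_⟩
  exact Pi.single_eq_of_ne (by rintro rfl; exact hw hv) _

open Classical in
theorem null_supportedOn [CompactSpace P.realization] {σ : Finset V} (hσ : σ ∈ P.faces)
    (hne : σ.Nonempty) (m : ℕ) : Null K m (supportedOn P σ) (supportedOn P σ) := by
  obtain ⟨v, hv⟩ := hne
  have hp := single_mem_closedSimplex hv
  set p : P.realization := ⟨Pi.single v 1, closedSimplex_subset_realization hσ hp⟩ with hpdef
  have hpS : p ∈ supportedOn P σ := hp.2
  set G : ℝ → P.realization → V → ℝ := fun t x => (1 - t) • (x : V → ℝ) + t • (p : V → ℝ) with hG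
  have hGmem : ∀ t ∈ Set.Icc (0 : ℝ) 1, ∀ x ∈ supportedOn P σ, G t x ∈ closedSimplex σ :=
    fun t ht x hx => convex_closedSimplex σ ⟨coe_mem_stdSimplex x, hx⟩ hp (by linarith [ht.2]) ht.1
      (by ring)
  have hGR : ∀ t ∈ Set.Icc (0 : ℝ) 1, ∀ x ∈ supportedOn P σ, G t x ∈ P.realization :=
    fun t ht x hx => closedSimplex_subset_realization hσ (hGmem t ht x hx)
  set H : ℝ → P.realization → P.realization := fun t x =>
    if h : G t x ∈ P.realization then ⟨G t x, h⟩ else x with hH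
  have hHG : ∀ t ∈ Set.Icc (0 : ℝ) 1, ∀ x ∈ supportedOn P σ, (H t x : V → ℝ) = G t x := by
    intro t ht x hx
    simp [hH, hGR t ht x hx]
  refine Null.of_homotopy (D := {p}) (isClosed_supportedOn σ).isCompact H ?_ ?_ ?_ ?_
    (Null.singleton hpS)
  · rw [Topology.IsInducing.subtypeVal.continuousOn_iff]
    refine ContinuousOn.congr (f := fun q : ℝ × P.realization => G q.1 q.2)
      (Continuous.continuousOn (by fun_prop)) ?_
    rintro ⟨t, x⟩ ⟨ht, hx⟩
    exact hHG t ht x hx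
  · intro x hx
    ext1
    rw [hHG 0 (by simp) x hx]
    simp [hG]
  · intro x hx
    refine Subtype.ext ?_
    rw [hHG 1 (by simp) x hx]
    simp [hG]
  · intro t ht x hx w hw
    rw [hHG t ht x hx]
    exact (hGmem t ht x hx).2 w hw

end Realization

section Approximation

variable {K : Type*} [Field K] {V : Type} [LinearOrder V] {P : ASC V}

/-- A chain endomorphism of oriented chains that preserves the span of each face in a subcomplex
and fixes the empty face is the identity there. -/
theorem eq_self_of_carried (J : Finset V) (g : (Finset V →₀ K) →ₗ[K] (Finset V →₀ K))
    (h0 : g (Finsupp.single ∅ 1) = Finsupp.single ∅ 1)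
    (hc : ∀ σ ∈ P.faces, σ ⊆ J → g (Finsupp.single σ 1) ∈ Finsupp.supported K K {σ})
    (hg : ∀ σ ∈ P.faces, σ ⊆ J →
      faceBdry K (g (Finsupp.single σ 1)) = g (faceBdry K (Finsupp.single σ 1)))
    (σ : Finset V) (hσ : σ ∈ P.faces) (hσJ : σ ⊆ J) :
    g (Finsupp.single σ 1) = Finsupp.single σ 1 := by
  induction σ using Finset.strongInduction with
  | H σ ih =>
  rcases σ.eq_empty_or_nonempty with rfl | ⟨v, hv⟩
  · exact h0
  · obtain ⟨a, ha⟩ : ∃ a, g (Finsupp.single σ 1) = Finsupp.single σ a := by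
      refine ⟨g (Finsupp.single σ 1) σ, ?_⟩
      rw [← Finsupp.support_subset_singleton]
      have := (Finsupp.mem_supported K _).1 (hc σ hσ hσJ)
      exact_mod_cast this
    have h1 : g (faceBdry K (Finsupp.single σ 1)) = faceBdry K (Finsupp.single σ 1) := by
      refine eq_on_supported g LinearMap.id ?_ (faceBdry_mem σ)
      rintro τ ⟨hτ, hτc⟩
      exact ih τ (Finset.ssubset_iff_subset_ne.2 ⟨hτ, by rintro rfl; omega⟩)
        (P.down_closed hσ hτ) (hτ.trans hσJ)
    have h2 := hg σ hσ hσJ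
    have h3 : Finsupp.single σ a = a • Finsupp.single σ (1 : K) := by simp
    rw [h1, ha, h3, map_smul] at h2
    have h4 : faceBdry K (Finsupp.single σ (1 : K)) (σ.erase v) = faceSign K σ v := by
      rw [faceBdry_single, Finsupp.finsetSum_apply, Finset.sum_eq_single_of_mem v hv,
        Finsupp.single_eq_same]
      intro w hw hwv
      refine Finsupp.single_eq_of_ne fun h => ?_
      have : w ∈ σ.erase v := Finset.mem_erase.2 ⟨hwv, hw⟩
      rw [h] at this
      exact Finset.notMem_erase w σ this
    have h5 := DFunLike.congr_fun h2 (σ.erase v)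
    rw [Finsupp.smul_apply, h4, smul_eq_mul] at h5
    have h6 : faceSign K σ v ≠ 0 := left_ne_zero_of_mul_eq_one (faceSign_mul_self σ v)
    rw [ha, mul_eq_right₀ h6 |>.1 h5]

variable [Fintype V]

/-- Oriented chains of faces can be replaced by arbitrarily fine chains of points, compatibly with
boundaries and supports. -/
theorem exists_fine_chains [CompactSpace P.realization] (k : ℕ) {δ : ℝ} (hδ : 0 < δ) :
    ∃ s : (Finset V →₀ K) →ₗ[K] (List P.realization →₀ K),
      s (Finsupp.single ∅ 1) = Finsupp.single [] 1 ∧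
      ∀ σ ∈ P.faces, σ.card ≤ k →
        s (Finsupp.single σ 1) ∈ small K σ.card δ (supportedOn P σ) ∧
        bdry K (s (Finsupp.single σ 1)) = s (faceBdry K (Finsupp.single σ 1)) := by
  induction k generalizing δ with
  | zero =>
    refine ⟨Finsupp.linearCombination K fun _ => Finsupp.single [] 1, by simp, ?_⟩
    intro σ _ hσ
    have : σ = ∅ := by simpa using hσ
    subst this
    refine ⟨?_, by simp [faceBdry_single]⟩
    simp only [Finsupp.linearCombination_single, one_smul]
    exact Finsupp.single_mem_supported K _ ⟨by simp, by simp, by simp⟩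
  | succ k ih =>
    have hnull : ∀ σ : Finset V, ∃ δ' > 0, σ ∈ P.faces → σ.Nonempty →
        ∀ z ∈ small K k δ' (supportedOn P σ), bdry K z = 0 →
          ∃ w ∈ small K (k + 1) δ (supportedOn P σ), bdry K w = z := by
      intro σ
      by_cases h : σ ∈ P.faces ∧ σ.Nonempty
      · obtain ⟨δ', h1, h2⟩ := null_supportedOn (K := K) h.1 h.2 k δ hδ
        exact ⟨δ', h1, fun _ _ => h2⟩
      · exact ⟨1, one_pos, fun h1 h2 => absurd ⟨h1, h2⟩ h⟩
    choose δ' hδ' hnull using hnull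
    have hne : (Finset.univ : Finset (Finset V)).Nonempty := ⟨∅, Finset.mem_univ _⟩
    set η := min δ (Finset.univ.inf' hne δ') with hη
    have hη0 : 0 < η := lt_min hδ ((Finset.lt_inf'_iff _).2 fun σ _ => hδ' σ)
    have hηle : ∀ σ, η ≤ δ' σ := fun σ =>
      (min_le_right _ _).trans (Finset.inf'_le _ (Finset.mem_univ σ))
    obtain ⟨s, hs0, hs⟩ := ih hη0
    have hmem : ∀ σ ∈ P.faces, σ.card = k + 1 →
        s (faceBdry K (Finsupp.single σ 1)) ∈ small K k η (supportedOn P σ) := by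
      intro σ hσ hcard
      refine map_mem_supported s ?_ (faceBdry_mem σ)
      rintro τ ⟨hτ, hτc⟩
      have hτk : τ.card = k := by omega
      have := (hs τ (P.down_closed hσ hτ) hτk.le).1
      rw [hτk] at this
      exact small_mono le_rfl (supportedOn_mono hτ) this
    have hcyc : ∀ σ ∈ P.faces, σ.card = k + 1 →
        bdry K (s (faceBdry K (Finsupp.single σ 1))) = 0 := by
      intro σ hσ hcard
      have : ((bdry K).comp s) (faceBdry K (Finsupp.single σ 1)) =
          (s.comp (faceBdry K)) (faceBdry K (Finsupp.single σ 1)) := by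
        refine eq_on_supported _ _ ?_ (faceBdry_mem σ)
        rintro τ ⟨hτ, hτc⟩
        exact (hs τ (P.down_closed hσ hτ) (by omega)).2
      rw [LinearMap.comp_apply, LinearMap.comp_apply, faceBdry_faceBdry, map_zero] at this
      exact this
    have hfill : ∀ σ : Finset V, ∃ w, σ ∈ P.faces → σ.card = k + 1 →
        w ∈ small K (k + 1) δ (supportedOn P σ) ∧
          bdry K w = s (faceBdry K (Finsupp.single σ 1)) := by
      intro σ
      by_cases h : σ ∈ P.faces ∧ σ.card = k + 1
      · obtain ⟨w, hw⟩ := hnull σ h.1 (Finset.card_pos.1 (by omega)) _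
          (small_mono (hηle σ) subset_rfl (hmem σ h.1 h.2)) (hcyc σ h.1 h.2)
        exact ⟨w, fun _ _ => hw⟩
      · exact ⟨0, fun h1 h2 => absurd ⟨h1, h2⟩ h⟩
    choose w hw using hfill
    set s' : (Finset V →₀ K) →ₗ[K] (List P.realization →₀ K) :=
      Finsupp.linearCombination K
        fun σ => if σ.card = k + 1 then w σ else s (Finsupp.single σ 1) with hs'
    have hs'1 : ∀ σ : Finset V, σ.card = k + 1 → s' (Finsupp.single σ 1) = w σ := by
      intro σ h
      simp [hs', h]
    have hs'2 : ∀ σ : Finset V, σ.card ≠ k + 1 →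
        s' (Finsupp.single σ 1) = s (Finsupp.single σ 1) := by
      intro σ h
      simp [hs', h]
    have hs'3 : ∀ σ : Finset V, σ.card ≤ k + 1 →
        s' (faceBdry K (Finsupp.single σ 1)) = s (faceBdry K (Finsupp.single σ 1)) := by
      intro σ h
      refine eq_on_supported _ _ ?_ (faceBdry_mem σ)
      rintro τ ⟨_, hτc⟩
      exact hs'2 τ (by omega)
    refine ⟨s', by rw [hs'2 _ (by simp), hs0], fun σ hσ hcard => ?_⟩
    rw [hs'3 σ hcard]
    by_cases h : σ.card = k + 1
    · rw [hs'1 σ h, h]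
      exact hw σ hσ h
    · rw [hs'2 σ h]
      obtain ⟨h1, h2⟩ := hs σ hσ (by omega)
      exact ⟨small_mono (min_le_left _ _) subset_rfl h1, h2⟩

/-- Nullity of cycles in the topological complement of the points vanishing on `J` gives nullity
of simplicial cycles in the subcomplex on `J`. -/
theorem exists_filling [CompactSpace P.realization] (hP : ∅ ∈ P.faces) (J : Finset V) {m : ℕ}
    (h : NullOff K m (supportedOn P J) (supportedOn P Jᶜ)) {z : Finset V →₀ K}
    (hz : z ∈ Finsupp.supported K K {σ | σ ∈ P.faces ∧ σ ⊆ J ∧ σ.card = m})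
    (hz' : faceBdry K z = 0) :
    ∃ w ∈ Finsupp.supported K K {σ | σ ∈ P.faces ∧ σ ⊆ J ∧ σ.card = m + 1},
      faceBdry K w = z := by
  obtain ⟨C', hC', hd, hN⟩ := h
  have hposC : ∀ x ∈ C', ∃ v ∈ J, 0 < (x : V → ℝ) v := by
    intro x hx
    by_contra! hcon
    refine Set.disjoint_left.1 hd hx fun v hv => ?_
    rw [Finset.mem_compl, not_not] at hv
    exact le_antisymm (hcon v hv) (x.2.1 v)
  have hφ : ∀ x : P.realization, ∃ v, (∃ u ∈ J, 0 < (x : V → ℝ) u) →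
      v ∈ J ∧ ∀ u ∈ J, (x : V → ℝ) u ≤ (x : V → ℝ) v := by
    intro x
    by_cases hx : ∃ u ∈ J, 0 < (x : V → ℝ) u
    · obtain ⟨u, hu, -⟩ := hx
      obtain ⟨v, hv, h⟩ := Finset.exists_max_image J (x : V → ℝ) ⟨u, hu⟩
      exact ⟨v, fun _ => ⟨hv, h⟩⟩
    · exact ⟨(exists_pos x).choose, fun h => absurd h hx⟩
  choose φ hφ using hφ
  obtain ⟨ε, hε, hεC⟩ : ∃ ε > 0, ∀ x ∈ C', ε ≤ (x : V → ℝ) (φ x) := by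
    rcases C'.eq_empty_or_nonempty with rfl | hne
    · exact ⟨1, one_pos, by simp⟩
    have hcont : Continuous fun x : P.realization => ∑ v ∈ J, (x : V → ℝ) v :=
      continuous_finsetSum _ fun v _ => (continuous_apply v).comp continuous_subtype_val
    obtain ⟨y, hy, hmin⟩ := hC'.isCompact.exists_isMinOn hne hcont.continuousOn
    obtain ⟨u, hu, hupos⟩ := hposC y hy
    have hJ : 0 < (J.card : ℝ) := by exact_mod_cast Finset.card_pos.2 ⟨u, hu⟩
    have hc : 0 < ∑ v ∈ J, (y : V → ℝ) v := Finset.sum_pos' (fun v _ => y.2.1 v) ⟨u, hu, hupos⟩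
    refine ⟨(∑ v ∈ J, (y : V → ℝ) v) / J.card, by positivity, fun x hx => ?_⟩
    rw [div_le_iff₀ hJ]
    refine (hmin hx).trans ?_
    have := Finset.sum_le_card_nsmul J (x : V → ℝ) _ (hφ x (hposC x hx)).2
    rwa [nsmul_eq_mul, mul_comm] at this
  obtain ⟨δ, hδ, hN⟩ := hN ε hε
  obtain ⟨s, hs0, hs⟩ := exists_fine_chains (K := K) (P := P) (Fintype.card V) hδ
  have hs := fun σ hσ => hs σ hσ (Finset.card_le_univ σ)
  set F : (List P.realization →₀ K) →ₗ[K] (Finset V →₀ K) := (orient K).comp (pushList K φ)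
    with hF
  have hFd : ∀ c, faceBdry K (F c) = F (bdry K c) := by
    intro c
    rw [hF, LinearMap.comp_apply, faceBdry_orient, bdry_pushList, LinearMap.comp_apply]
  have hFsupp : ∀ l, F (Finsupp.single l 1) ∈
      Finsupp.supported K K {τ : Finset V | (∀ v ∈ τ, ∃ x ∈ l, φ x = v) ∧ τ.card = l.length} := by
    intro l
    rw [hF, LinearMap.comp_apply, pushList_single, orient_single]
    refine supported_mono' ?_ (orientList_mem _)
    rintro τ ⟨h1, h2⟩
    exact ⟨fun v hv => by simpa using (h1 v).1 hv, by simpa using h2⟩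
  have hid : ∀ σ ∈ P.faces, σ ⊆ J → F (s (Finsupp.single σ 1)) = Finsupp.single σ 1 := by
    refine eq_self_of_carried (P := P) J (F.comp s) ?_ ?_ ?_
    · simp [hs0, hF, orient_single, orientList]
    · intro σ hσ hσJ
      refine map_mem_supported F ?_ (hs σ hσ).1
      intro l hl
      refine supported_mono' ?_ (hFsupp l)
      rintro τ ⟨h1, h2⟩
      refine Finset.eq_of_subset_of_card_le ?_ (by rw [h2, hl.1])
      intro v hv
      obtain ⟨x, hx, rfl⟩ := h1 v hv
      by_contra hcon
      have hx0 := hl.2.1 x hx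
      obtain ⟨u, hu⟩ := exists_pos x
      have huσ : u ∈ σ := by
        by_contra h
        exact hu.ne' (hx0 u h)
      have := (hφ x ⟨u, hσJ huσ, hu⟩).2 u (hσJ huσ)
      rw [hx0 _ hcon] at this
      linarith
    · intro σ hσ hσJ
      rw [LinearMap.comp_apply, hFd, (hs σ hσ).2]
      rfl
  have hsz : s z ∈ small K m δ (supportedOn P J) := by
    refine map_mem_supported s ?_ hz
    rintro σ ⟨h1, h2, h3⟩
    have := (hs σ h1).1
    rw [h3] at this
    exact small_mono le_rfl (supportedOn_mono h2) this
  have hszd : bdry K (s z) = 0 := by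
    have : ((bdry K).comp s) z = (s.comp (faceBdry K)) z :=
      eq_on_supported _ _ (fun σ hσ => (hs σ hσ.1).2) hz
    rw [LinearMap.comp_apply, LinearMap.comp_apply, hz', map_zero] at this
    exact this
  obtain ⟨w, hw, hwz⟩ := hN (s z) hsz hszd
  refine ⟨F w, map_mem_supported F ?_ hw, ?_⟩
  · intro l hl
    refine supported_mono' ?_ (hFsupp l)
    rintro τ ⟨h1, h2⟩
    refine ⟨?_, ?_, by rw [h2, hl.1]⟩
    · rcases l with _ | ⟨y, l⟩
      · have : τ = ∅ := Finset.card_eq_zero.1 h2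
        rwa [this]
      · refine mem_faces_of_pos y fun v hv => ?_
        obtain ⟨x, hx, rfl⟩ := h1 v hv
        have h3 := hl.2.2 x hx y (by simp)
        rw [Subtype.dist_eq] at h3
        have h4 := (dist_le_pi_dist (x : V → ℝ) y (φ x)).trans_lt h3
        rw [Real.dist_eq] at h4
        have h5 := le_abs_self ((x : V → ℝ) (φ x) - (y : V → ℝ) (φ x))
        have h6 := hεC x (hl.2.1 x hx)
        linarith
    · intro v hv
      obtain ⟨x, hx, rfl⟩ := h1 v hv
      exact (hφ x (hposC x (hl.2.1 x hx))).1
  · rw [hFd, hwz]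
    exact eq_on_supported (F.comp s) LinearMap.id (fun σ hσ => hid σ hσ.1 hσ.2.1) hz

end Approximation

section Translation

variable {K : Type} [Field K] {V : Type} {Γ : ASC V}

variable (K) in
/-- Simplicial chains of `Γ` as oriented chains of the full simplex. -/
noncomputable def chainsInclusion (Γ : ASC V) (j : ℤ) :
    ASC.Chains K Γ j →ₗ[K] (Finset V →₀ K) :=
  Finsupp.lmapDomain K K (fun σ : ASC.Cells Γ j => σ.1)

theorem chainsInclusion_injective (j : ℤ) : Function.Injective (chainsInclusion K Γ j) :=
  Finsupp.mapDomain_injective Subtype.val_injective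

theorem range_chainsInclusion (j : ℤ) : LinearMap.range (chainsInclusion K Γ j) =
    Finsupp.supported K K {σ | σ ∈ Γ.faces ∧ (σ.card : ℤ) = j + 1} := by
  refine (Finsupp.range_lmapDomain _).trans ?_
  rw [Finsupp.supported_eq_span_single]
  congr 1
  ext x
  constructor
  · rintro ⟨σ, rfl⟩
    exact ⟨σ.1, σ.2, rfl⟩
  · rintro ⟨σ, hσ, rfl⟩
    exact ⟨⟨σ, hσ⟩, rfl⟩

variable [LinearOrder V]

theorem chainsInclusion_boundary {j k : ℤ} (hk : k = j - 1) (c : ASC.Chains K Γ j) :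
    chainsInclusion K Γ k (ASC.boundary K Γ j k hk c) = faceBdry K (chainsInclusion K Γ j c) := by
  have : (chainsInclusion K Γ k).comp (ASC.boundary K Γ j k hk) =
      (faceBdry K).comp (chainsInclusion K Γ j) := by
    refine Finsupp.lhom_ext' fun σ => LinearMap.ext_ring ?_
    have h1 : chainsInclusion K Γ j (Finsupp.single σ 1 : ASC.Cells Γ j →₀ K) =
      Finsupp.single σ.1 1 := Finsupp.mapDomain_single
    have h2 : ASC.boundary K Γ j k hk (Finsupp.single σ 1 : ASC.Cells Γ j →₀ K) = _ :=
      (Finsupp.lsum_single K _ σ 1).trans (LinearMap.toSpanSingleton_apply _ _ _ _)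
    refine (congrArg (chainsInclusion K Γ k) h2).trans ?_
    refine Eq.trans ?_ (congrArg (faceBdry K) h1).symm
    rw [one_smul, faceBdry_single, ← Finset.sum_attach]
    refine (map_sum (chainsInclusion K Γ k) _ _).trans ?_
    exact Finset.sum_congr rfl fun v _ => Finsupp.mapDomain_single
  exact LinearMap.congr_fun this c

theorem subsingleton_reducedHomology (j : ℤ)
    (h : ∀ z ∈ Finsupp.supported K K {σ | σ ∈ Γ.faces ∧ (σ.card : ℤ) = j + 1},
      faceBdry K z = 0 →
      ∃ w ∈ Finsupp.supported K K {σ | σ ∈ Γ.faces ∧ (σ.card : ℤ) = j + 1 + 1},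
        faceBdry K w = z) :
    Subsingleton (ASC.reducedHomology K Γ j) := by
  rw [Submodule.Quotient.subsingleton_iff, eq_top_iff]
  rintro ⟨z, hz⟩ -
  obtain ⟨w, hw, hwz⟩ := h (chainsInclusion K Γ j z)
    (by rw [← range_chainsInclusion]; exact ⟨z, rfl⟩)
    (by rw [← chainsInclusion_boundary rfl, LinearMap.mem_ker.1 hz, map_zero])
  rw [← range_chainsInclusion] at hw
  obtain ⟨w, rfl⟩ := hw
  exact ⟨w, chainsInclusion_injective j ((chainsInclusion_boundary _ w).trans hwz)⟩

end Translation

section Combinatorics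

variable {V : Type} {P : ASC V}

theorem exists_isMinimalNonFace_subset {σ : Finset V} (hσ : σ ∉ P.faces) :
    ∃ J ⊆ σ, P.IsMinimalNonFace J := by
  induction σ using Finset.strongInduction with
  | H σ ih =>
    by_cases h : ∀ J ⊂ σ, J ∈ P.faces
    · exact ⟨σ, subset_rfl, hσ, h⟩
    · push Not at h
      obtain ⟨τ, hτ, hτP⟩ := h
      obtain ⟨J, hJ, hJP⟩ := ih τ hτ hτP
      exact ⟨J, hJ.trans hτ.1, hJP⟩

/-- A nonempty set that is not a union of minimal non-faces induces a cone. -/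
theorem exists_insert_mem_faces [DecidableEq V] {I : Finset V} (hne : I.Nonempty)
    (hI : ¬ P.memUSR I) :
    ∃ v ∈ I, ∀ τ ∈ P.faces, τ ⊆ I → insert v τ ∈ P.faces := by
  classical
  obtain ⟨v, hv, hvJ⟩ : ∃ v ∈ I, ∀ J ⊆ I, P.IsMinimalNonFace J → v ∉ J := by
    by_contra! hcon
    refine hI ⟨I.powerset.filter P.IsMinimalNonFace, ?_, ?_, ?_⟩
    · obtain ⟨v, hv⟩ := hne
      obtain ⟨J, h1, h2, -⟩ := hcon v hv
      exact ⟨J, by simp [h1, h2]⟩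
    · intro J hJ
      exact (Finset.mem_filter.1 hJ).2
    · refine Finset.Subset.antisymm (fun v hv => ?_) (Finset.sup_le fun J hJ => ?_)
      · obtain ⟨J, h1, h2, h3⟩ := hcon v hv
        exact Finset.mem_sup.2 ⟨J, by simp [h1, h2], h3⟩
      · exact Finset.mem_powerset.1 (Finset.mem_filter.1 hJ).1
  refine ⟨v, hv, fun τ hτ hτI => ?_⟩
  by_contra hcon
  obtain ⟨J, hJ, hJP⟩ := exists_isMinimalNonFace_subset hcon
  have hvJ' := hvJ J (hJ.trans (Finset.insert_subset hv hτI)) hJP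
  exact hJP.1 (P.down_closed hτ ((Finset.subset_insert_iff_of_notMem hvJ').1 hJ))

end Combinatorics

section Sphere

variable {K : Type} [Field K] {V : Type} [Fintype V] [LinearOrder V] {P : ASC V}

theorem disjoint_supportedOn_compl (I : Finset V) :
    Disjoint (supportedOn P Iᶜ) (supportedOn P I) := by
  refine Set.disjoint_left.2 fun x hx hx' => ?_
  obtain ⟨v, hv⟩ := exists_pos x
  by_cases h : v ∈ I
  · exact hv.ne' (hx v (by simpa using h))
  · exact hv.ne' (hx' v h)

/-- If all faces in `I` can be joined with `v ∈ I`, then the part of the realization supported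
on `I` is star-shaped, so its complement is acyclic. -/
theorem acyclicCompl_supportedOn [CompactSpace P.realization]
    (hpt : ∀ p : P.realization, AcyclicCompl K {p}) (hP : ∅ ∈ P.faces) {I : Finset V} {v : V}
    (hv : v ∈ I) (hins : ∀ τ ∈ P.faces, τ ⊆ I → insert v τ ∈ P.faces) :
    AcyclicCompl K (supportedOn P I) := by
  classical
  let s := I.powerset.filter (· ∈ P.faces)
  have hs : ∀ {τ}, τ ∈ s ↔ τ ⊆ I ∧ τ ∈ P.faces := by simp [s]
  have he : supportedOn P I = (↑) ⁻¹' (⋃ τ ∈ s, closedSimplex (insert v τ)) := by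
    ext x
    simp only [Set.mem_preimage, Set.mem_iUnion]
    constructor
    · intro hx
      refine ⟨Finset.univ.filter (0 < (x : V → ℝ) ·), hs.2 ⟨fun w hw => ?_, ?_⟩,
        coe_mem_stdSimplex x, fun w hw => ?_⟩
      · by_contra h
        exact (Finset.mem_filter.1 hw).2.ne' (hx w h)
      · exact mem_faces_of_pos x fun w hw => (Finset.mem_filter.1 hw).2
      · simp only [Finset.mem_insert, Finset.mem_filter, Finset.mem_univ, true_and,
          not_or, not_lt] at hw
        exact le_antisymm hw.2 (x.2.1 w)
    · rintro ⟨τ, hτ, hx⟩ w hw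
      exact hx.2 w fun h => hw (Finset.insert_subset hv (hs.1 hτ).1 h)
  rw [he]
  refine AcyclicCompl.of_iUnion_convex hpt s ⟨∅, hs.2 ⟨Finset.empty_subset I, hP⟩⟩ _
    (p := Pi.single v 1) ?_ ?_ ?_ ?_
  · exact fun τ hτ => closedSimplex_subset_realization (hins τ (hs.1 hτ).2 (hs.1 hτ).1)
  · exact fun τ _ => isCompact_closedSimplex _
  · exact fun τ _ => single_mem_closedSimplex (Finset.mem_insert_self v τ)
  · exact fun τ _ => convex_closedSimplex _

theorem nullOff_supportedOn {d : ℕ} [CompactSpace P.realization]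
    (e : P.realization ≃ₜ Metric.sphere (0 : EuclideanSpace ℝ (Fin d)) 1) (hP : ∅ ∈ P.faces)
    {I : Finset V} (hI : ¬ P.memUSR I) {m : ℕ} (hm : m + 1 ≤ d) :
    NullOff K m (supportedOn P Iᶜ) (supportedOn P I) := by
  rcases I.eq_empty_or_nonempty with rfl | hne
  · refine ⟨Set.univ, isClosed_univ, ?_, ?_⟩
    · refine Set.disjoint_left.2 fun x _ hx => ?_
      obtain ⟨v, hv⟩ := exists_pos x
      exact hv.ne' (hx v (Finset.notMem_empty v))
    · have h := (null_coordSphere (K := K) (Finset.univ : Finset (Fin d)) m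
        (by simpa using hm)).preimage_homeomorph e
      refine h.mono ?_ ?_
      · intro x _
        simp [coordSphere]
      · exact Set.subset_univ _
  · obtain ⟨v, hv, hins⟩ := exists_insert_mem_faces hne hI
    refine acyclicCompl_supportedOn (fun p => ?_) hP hv hins m _ (isClosed_supportedOn _)
      (disjoint_supportedOn_compl I)
    have h := (acyclicCompl_point_sphere (K := K) (e p)).preimage_homeomorph e
    rwa [← Set.image_singleton, e.preimage_image] at h

end Sphere

end ListChain

/-- Theorem 1.1(a): let `P` be a simplicial complex with `‖P‖ ≅ S^{d-1}`.  For every `I ⊆ V` and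
every integer `i ≥ 1`, the reduced homology `H̃_{d-1-i}(P_{≤Î}; K)` vanishes unless `I` is a
union of minimal non-faces of `P` (i.e. unless `I ∈ U_SR`). -/
theorem vanishing_unless_union_of_minimal_nonfaces {V : Type} [Fintype V] [LinearOrder V]
    (K : Type) [Field K] (d : ℕ) (P : ASC V)
    (hP : Nonempty (↥(ASC.realization P) ≃ₜ
      ↥(Metric.sphere (0 : EuclideanSpace ℝ (Fin d)) 1)))
    (I : Finset V) (i : ℤ) (hi : 1 ≤ i) (hI : ¬ P.memUSR I) :
    Subsingleton (ASC.reducedHomology K (P.restrict Iᶜ) ((d : ℤ) - 1 - i)) := by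
  obtain ⟨e⟩ := hP
  have : CompactSpace P.realization := e.symm.compactSpace
  refine ListChain.subsingleton_reducedHomology _ fun z hz hz' => ?_
  rcases lt_or_ge ((d : ℤ) - i) 0 with hneg | hpos
  · refine ⟨0, Submodule.zero_mem _, ?_⟩
    rw [map_zero, eq_comm, ← Finsupp.support_eq_empty, Finset.eq_empty_iff_forall_notMem]
    intro σ hσ
    have := ((Finsupp.mem_supported K _).1 hz hσ).2
    omega
  · obtain ⟨m, hm⟩ := Int.eq_ofNat_of_zero_le hpos
    have hmd : m + 1 ≤ d := by omega
    have hfaces : ∅ ∈ P.faces := by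
      have hd : Nonempty (Fin d) := ⟨⟨m, hmd⟩⟩
      obtain ⟨x, hx⟩ := (NormedSpace.sphere_nonempty (x := (0 : EuclideanSpace ℝ (Fin d)))).2
        zero_le_one
      exact ListChain.mem_faces_of_pos (e.symm ⟨x, hx⟩) (by simp)
    have hdim : ∀ n : ℕ, {σ | σ ∈ P.faces ∧ σ ⊆ Iᶜ ∧ σ.card = m + n} =
        {σ | σ ∈ (P.restrict Iᶜ).faces ∧ (σ.card : ℤ) = d - 1 - i + 1 + n} := by
      intro n
      ext σ
      have : σ.card = m + n ↔ (σ.card : ℤ) = d - 1 - i + 1 + n := by omega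
      simp [ASC.restrict, and_assoc, this]
    have h0 := hdim 0
    have h1 := hdim 1
    simp only [Nat.cast_zero, add_zero, Nat.cast_one] at h0 h1
    rw [← h0] at hz
    rw [← h1]
    refine ListChain.exists_filling hfaces Iᶜ ?_ hz hz'
    rw [compl_compl]
    exact ListChain.nullOff_supportedOn e hfaces hI hmd
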